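/- Let p be a prime and G a permutation group of degree n > 1 (a subgroup of the symmetric group S_n) such that p does not divide |G|. Then |G| < p^(n-1). -/

import Mathlib

open Equiv
open scoped Pointwise

namespace PG

def orb {α : Type*} (H : Subgroup (Perm α)) : Setoid α where
  r x y := ∃ h ∈ H, h x = y
  iseqv := ⟨fun x => ⟨1, H.one_mem, rfl⟩,
    fun {x y} ⟨h, hh, e⟩ => ⟨h⁻¹, H.inv_mem hh, by rw [← e]; simp⟩,
    fun {x y z} ⟨h, hh, e⟩ ⟨h', hh', e'⟩ => ⟨h' * h, H.mul_mem hh' hh, by simp [e, e']⟩⟩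

noncomputable def kk {α : Type*} (H : Subgroup (Perm α)) : ℕ := Nat.card (Quotient (orb H))

def Good (p : ℕ) (α : Type*) : Prop :=
  ∀ H : Subgroup (Perm α), ¬ p ∣ Nat.card H → H ≠ ⊥ →
    Nat.card H * p ^ kk H < p ^ Nat.card α

lemma orb_iff {α : Type*} (H : Subgroup (Perm α)) (x y : α) :
    (orb H) x y ↔ ∃ h ∈ H, h x = y := Iff.rfl

lemma kk_bot (α : Type*) : kk (⊥ : Subgroup (Perm α)) = Nat.card α := by
  unfold kk
  symm
  apply Nat.card_eq_of_bijective (fun x => (Quotient.mk (orb ⊥) x))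
  constructor
  · intro x y h
    obtain ⟨h, hh, e⟩ := Quotient.exact h
    rw [Subgroup.mem_bot] at hh
    subst hh; simpa using e
  · intro x; exact Quotient.exists_rep x

lemma Good.le {p : ℕ} {α : Type*} (hg : Good p α) (H : Subgroup (Perm α))
    (hp : ¬ p ∣ Nat.card H) : Nat.card H * p ^ kk H ≤ p ^ Nat.card α := by
  by_cases h : H = ⊥
  · subst h; rw [kk_bot]; simp
  · exact (hg H hp h).le

lemma kk_mono {α : Type*} [Finite α] {H K : Subgroup (Perm α)} (h : H ≤ K) : kk K ≤ kk H := by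
  unfold kk
  apply Nat.card_le_card_of_surjective
    (Quotient.map' (s₁ := orb H) (s₂ := orb K) id (fun x y ⟨g, hg, e⟩ => ⟨g, h hg, e⟩))
  intro x
  induction x using Quotient.inductionOn with | _ x
  exact ⟨Quotient.mk _ x, rfl⟩

lemma kk_le_card {α : Type*} [Finite α] (H : Subgroup (Perm α)) : kk H ≤ Nat.card α := by
  rw [← kk_bot]; exact kk_mono bot_le

lemma card_ker_range {K L : Type*} [Group K] [Group L] [Finite K] (φ : K →* L) :
    Nat.card K = Nat.card φ.ker * Nat.card φ.range := by
  rw [← Subgroup.card_mul_index φ.ker, Subgroup.index_ker]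

lemma range_ndvd {K L : Type*} [Group K] [Group L] [Finite K] (φ : K →* L) {p : ℕ}
    (h : ¬ p ∣ Nat.card K) : ¬ p ∣ Nat.card φ.range := fun h' => h <| by
  rw [card_ker_range φ]; exact Dvd.dvd.mul_left h' _

lemma ker_ndvd {K L : Type*} [Group K] [Group L] [Finite K] (φ : K →* L) {p : ℕ}
    (h : ¬ p ∣ Nat.card K) : ¬ p ∣ Nat.card φ.ker := fun h' => h <| by
  rw [card_ker_range φ]; exact Dvd.dvd.mul_right h' _

/-- restriction to an invariant set -/
def resHom {α : Type*} (H : Subgroup (Perm α)) (s : Set α)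
    (hs : ∀ h ∈ H, ∀ x, h x ∈ s ↔ x ∈ s) : H →* Perm s where
  toFun h := (h : Perm α).subtypePerm (hs h h.2)
  map_one' := by ext; simp
  map_mul' a b := by ext; rfl

@[simp] lemma resHom_apply {α : Type*} (H : Subgroup (Perm α)) (s : Set α)
    (hs : ∀ h ∈ H, ∀ x, h x ∈ s ↔ x ∈ s) (h : H) (x : s) :
    (resHom H s hs h x : α) = (h : Perm α) x := rfl

/-- action on the quotient by an invariant setoid -/
def quoHom {α : Type*} (H : Subgroup (Perm α)) (r : Setoid α)
    (hr : ∀ h ∈ H, ∀ x y, r x y → r (h x) (h y)) : H →* Perm (Quotient r) where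
  toFun h :=
    { toFun := Quotient.map' (h : Perm α) (fun x y => hr h h.2 x y)
      invFun := Quotient.map' ((h⁻¹ : H) : Perm α) (fun x y => hr _ (h⁻¹ : H).2 x y)
      left_inv := by rintro ⟨x⟩; apply Quotient.sound; simp [Setoid.refl]
      right_inv := by rintro ⟨x⟩; apply Quotient.sound; simp [Setoid.refl] }
  map_one' := by ext x; induction x using Quotient.inductionOn; rfl
  map_mul' a b := by ext x; induction x using Quotient.inductionOn; rfl

lemma quoHom_mk {α : Type*} (H : Subgroup (Perm α)) (r : Setoid α)
    (hr : ∀ h ∈ H, ∀ x y, r x y → r (h x) (h y)) (h : H) (x : α) :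
    quoHom H r hr h (Quotient.mk r x) = Quotient.mk r ((h : Perm α) x) := rfl

/-- kernel as a subgroup of Perm -/
def kerP {α L : Type*} [Group L] {H : Subgroup (Perm α)} (φ : H →* L) : Subgroup (Perm α) :=
  φ.ker.map H.subtype

lemma card_kerP {α L : Type*} [Group L] {H : Subgroup (Perm α)} (φ : H →* L) :
    Nat.card (kerP φ) = Nat.card φ.ker := 
  (Nat.card_congr (φ.ker.equivMapOfInjective _ H.subtype_injective).toEquiv).symm

lemma mem_kerP {α L : Type*} [Group L] {H : Subgroup (Perm α)} (φ : H →* L) (g : Perm α) :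
    g ∈ kerP φ ↔ ∃ hg : g ∈ H, φ ⟨g, hg⟩ = 1 := by
  unfold kerP
  simp [Subgroup.mem_map, MonoidHom.mem_ker]

lemma kerP_le {α L : Type*} [Group L] {H : Subgroup (Perm α)} (φ : H →* L) : kerP φ ≤ H := by
  intro g hg; exact ((mem_kerP φ g).1 hg).1

lemma card_split {α L : Type*} [Finite α] [Group L] {H : Subgroup (Perm α)} (φ : H →* L) :
    Nat.card H = Nat.card (kerP φ) * Nat.card φ.range := by
  rw [card_kerP, ← card_ker_range]

lemma kerP_ndvd {α L : Type*} [Finite α] [Group L] {H : Subgroup (Perm α)} (φ : H →* L) {p : ℕ}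
    (h : ¬ p ∣ Nat.card H) : ¬ p ∣ Nat.card (kerP φ) := by
  rw [card_kerP]; exact ker_ndvd φ h

lemma kk_pos {α : Type*} [Finite α] [Nonempty α] (H : Subgroup (Perm α)) : 0 < kk H := by
  unfold kk
  have : Nonempty (Quotient (orb H)) := ⟨Quotient.mk _ (Classical.arbitrary α)⟩
  exact Nat.card_pos

/-- intransitive reduction -/
lemma intrans {α : Type} [Finite α] {p : ℕ} (hp : p.Prime)
    (IH : ∀ (β : Type) [Finite β], Nat.card β < Nat.card α → Good p β)
    (H : Subgroup (Perm α)) (hH : ¬ p ∣ Nat.card H) (hb : H ≠ ⊥) (s : Set α)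
    (hs : ∀ h ∈ H, ∀ x, h x ∈ s ↔ x ∈ s) (hne : s.Nonempty) (hnu : sᶜ.Nonempty) :
    Nat.card H * p ^ kk H < p ^ Nat.card α := by
  classical
  have hcard : Nat.card s + Nat.card ↥(sᶜ) = Nat.card α := by
    simpa using Set.ncard_add_ncard_compl s
  have h1 : 0 < Nat.card s := by
    have := hne.to_subtype; exact Nat.card_pos
  have h2 : 0 < Nat.card ↥(sᶜ) := by
    have := hnu.to_subtype; exact Nat.card_pos
  set φ := resHom H s hs with hφ
  set N := kerP φ with hN
  have hs' : ∀ h ∈ N, ∀ x, h x ∈ sᶜ ↔ x ∈ sᶜ := by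
    intro h hh x
    simp only [Set.mem_compl_iff]
    rw [hs h (kerP_le φ hh)]
  set ψ := resHom N sᶜ hs' with hψ
  have hinj : Function.Injective ψ := by
    rw [injective_iff_map_eq_one]
    intro a ha
    ext x
    by_cases hx : x ∈ s
    · obtain ⟨hg, e⟩ := (mem_kerP φ _).1 a.2
      have := congrArg (fun f : Perm s => ((f ⟨x, hx⟩ : s) : α)) e
      simpa [hφ] using this
    · have := congrArg (fun f : Perm ↥(sᶜ) => ((f ⟨x, hx⟩ : ↥(sᶜ)) : α)) ha
      simpa [hψ] using this
  have hNr : Nat.card N = Nat.card ψ.range :=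
    Nat.card_congr (MonoidHom.ofInjective hinj).toEquiv
  have hk : kk H ≤ kk φ.range + kk ψ.range := by
    unfold kk
    rw [← Nat.card_sum]
    apply Nat.card_le_card_of_surjective (Sum.elim
      (Quotient.map' (s₁ := orb φ.range) (s₂ := orb H) (fun x => (x : α)) ?_)
      (Quotient.map' (s₁ := orb ψ.range) (s₂ := orb H) (fun x => (x : α)) ?_))
    · intro x
      induction x using Quotient.inductionOn with | _ x
      by_cases hx : x ∈ s
      · exact ⟨Sum.inl (Quotient.mk _ ⟨x, hx⟩), rfl⟩
      · exact ⟨Sum.inr (Quotient.mk _ ⟨x, hx⟩), rfl⟩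
    · rintro x y ⟨_, ⟨g, rfl⟩, e⟩
      exact ⟨g, g.2, by rw [← e]; rfl⟩
    · rintro x y ⟨_, ⟨g, rfl⟩, e⟩
      exact ⟨g, kerP_le φ g.2, by rw [← e]; rfl⟩
  have g1 := IH s (by omega)
  have g2 := IH ↥(sᶜ) (by omega)
  have d1 : ¬ p ∣ Nat.card φ.range := range_ndvd φ hH
  have d2 : ¬ p ∣ Nat.card ψ.range := by
    rw [← hNr]; exact kerP_ndvd φ hH
  have l1 := g1.le _ d1
  have l2 := g2.le _ d2
  have hc : Nat.card H = Nat.card ψ.range * Nat.card φ.range := by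
    rw [← hNr]; exact card_split φ
  have key : Nat.card H * p ^ kk H ≤
      (Nat.card φ.range * p ^ kk φ.range) * (Nat.card ψ.range * p ^ kk ψ.range) := by
    calc Nat.card H * p ^ kk H ≤ Nat.card H * p ^ (kk φ.range + kk ψ.range) := by
          gcongr; exact hp.pos
      _ = _ := by rw [hc, pow_add]; ring
  refine lt_of_le_of_lt key ?_
  rw [← hcard, pow_add]
  by_cases hb1 : φ.range = ⊥
  · have hb2 : ψ.range ≠ ⊥ := by
      intro hb2
      apply hb
      rw [← Subgroup.card_eq_one, hc, hb1, hb2]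
      simp
    exact mul_lt_mul' l1 (g2 _ d2 hb2) (Nat.zero_le _) (pow_pos hp.pos _)
  · exact Nat.mul_lt_mul_of_lt_of_le (g1 _ d1 hb1) l2 (pow_pos hp.pos _)

lemma card_quo_le_kk {α : Type*} [Finite α] (H : Subgroup (Perm α)) (r : Setoid α)
    (hr : ∀ h ∈ H, ∀ x y, r x y → r (h x) (h y)) :
    Nat.card (Quotient r) ≤ kk (kerP (quoHom H r hr)) := by
  unfold kk
  apply Nat.card_le_card_of_surjective
    (Quotient.map' (s₁ := orb (kerP (quoHom H r hr))) (s₂ := r) id ?_)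
  · intro x
    induction x using Quotient.inductionOn with | _ x
    exact ⟨Quotient.mk _ x, rfl⟩
  · rintro x y ⟨g, hg, rfl⟩
    obtain ⟨h, e⟩ := (mem_kerP _ _).1 hg
    have := congrArg (fun f : Perm (Quotient r) => f (Quotient.mk r x)) e
    exact (Quotient.exact this.symm : r x (g x))

lemma kk_le_kk_quo {α : Type*} [Finite α] (H : Subgroup (Perm α)) (r : Setoid α)
    (hr : ∀ h ∈ H, ∀ x y, r x y → r (h x) (h y)) (hle : ∀ x y, r x y → (orb H) x y) :
    kk H ≤ kk (quoHom H r hr).range := by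
  unfold kk
  apply Nat.card_le_card_of_surjective
    (Quotient.lift (s := orb (quoHom H r hr).range)
      (Quotient.map' (s₁ := r) (s₂ := orb H) id hle) ?_)
  · intro x
    induction x using Quotient.inductionOn with | _ x
    exact ⟨Quotient.mk _ (Quotient.mk _ x), rfl⟩
  · rintro ⟨x⟩ ⟨y⟩ ⟨_, ⟨g, rfl⟩, e⟩
    apply Quotient.sound
    have e' : r ((g : Perm α) x) y := Quotient.exact e
    exact (orb H).trans ⟨g, g.2, rfl⟩ (hle _ _ e')

lemma exists_setoid {M β : Type*} [Group M] [MulAction M β] [MulAction.IsPretransitive M β]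
    (h : ¬ MulAction.IsPreprimitive M β) :
    ∃ r : Setoid β, (∀ (g : M) x y, r x y → r (g • x) (g • y)) ∧ (∃ x y, x ≠ y ∧ r x y) ∧
      (∃ x y, ¬ r x y) := by
  have : ∃ B : Set β, MulAction.IsBlock M B ∧ ¬ MulAction.IsTrivialBlock B := by
    by_contra hc
    push Not at hc
    exact h ⟨fun {B} hB => hc B hB⟩
  obtain ⟨B, hB, hT⟩ := this
  have hT' : ¬ B.Subsingleton ∧ B ≠ Set.univ := by
    rw [← not_or]; exact hT
  obtain ⟨h1, h2⟩ := hT'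
  rw [Set.not_subsingleton_iff] at h1
  obtain ⟨x, hx, y, hy, hxy⟩ := h1
  obtain ⟨z, hz⟩ := (Set.ne_univ_iff_exists_notMem B).1 h2
  refine ⟨⟨fun x y => ∀ g : M, x ∈ g • B ↔ y ∈ g • B, ⟨fun _ _ => Iff.rfl,
    fun h g => (h g).symm, fun h h' g => (h g).trans (h' g)⟩⟩, ?_, ⟨x, y, hxy, ?_⟩, x, z, ?_⟩
  · intro g x y hxy g'
    have := hxy (g⁻¹ * g')
    simpa [mul_smul, Set.mem_inv_smul_set_iff] using this
  · intro g
    have key : ∀ x y, x ∈ B → y ∈ B → x ∈ g • B → y ∈ g • B := by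
      intro x y hx hy hxg
      have := (hB.smul_eq_or_disjoint g)
      rcases this with h | h
      · rw [h]; exact hy
      · exact absurd hx (Set.disjoint_left.1 h hxg)
    exact ⟨key x y hx hy, key y x hy hx⟩
  · intro hc
    have := (hc 1)
    simp [hx, hz] at this

lemma prim_setoid {M β : Type*} [Group M] [MulAction M β] (h : MulAction.IsPreprimitive M β)
    (r : Setoid β) (hr : ∀ (g : M) x y, r x y → r (g • x) (g • y)) (x y : β) (hxy : x ≠ y)
    (h1 : r x y) (a b : β) : r a b := by
  have hB : MulAction.IsBlock M {z | r x z} := by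
    rw [MulAction.isBlock_iff_smul_eq_or_disjoint]
    intro g
    by_cases hg : r x (g • x)
    · left
      ext z
      rw [Set.mem_smul_set_iff_inv_smul_mem]
      constructor
      · intro hz
        have := hr g _ _ hz
        simp at this
        exact r.trans hg this
      · intro hz
        have := hr g⁻¹ _ _ (r.trans (r.symm hg) hz)
        simpa using this
    · right
      rw [Set.disjoint_left]
      intro z hz hz'
      rw [Set.mem_smul_set_iff_inv_smul_mem] at hz
      have := hr g _ _ hz
      simp at this
      exact hg (r.trans hz' (r.symm this))
  rcases h.isTrivialBlock_of_isBlock hB with h | h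
  · exact absurd (h (r.refl x : r x x) h1) hxy
  · have : ∀ z, r x z := fun z => by
      have : z ∈ {z | r x z} := by rw [h]; trivial
      exact this
    exact r.trans (r.symm (this a)) (this b)

lemma kk_trans {α : Type*} [Finite α] (H : Subgroup (Perm α)) [Nonempty α]
    (h : MulAction.IsPretransitive H α) : kk H = 1 := by
  have : kk H ≤ 1 := by
    unfold kk
    rw [Finite.card_le_one_iff_subsingleton]
    constructor
    rintro ⟨x⟩ ⟨y⟩
    apply Quotient.sound
    obtain ⟨g, hg⟩ := h.exists_smul_eq x y
    exact ⟨g, g.2, hg⟩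
  have := kk_pos H
  omega

lemma card_quo_lt {α : Type*} [Finite α] (r : Setoid α) (x y : α) (hxy : x ≠ y) (h : r x y) :
    Nat.card (Quotient r) < Nat.card α := by
  have := Fintype.ofFinite α
  have := Fintype.ofFinite (Quotient r)
  rw [Nat.card_eq_fintype_card, Nat.card_eq_fintype_card]
  apply Fintype.card_lt_of_surjective_not_injective (Quotient.mk r) Quotient.mk_surjective
  intro hi
  exact hxy (hi (Quotient.sound h))

/-- imprimitive reduction -/
lemma imprim {α : Type} [Finite α] {p : ℕ} (hp : p.Prime)
    (IH : ∀ (β : Type) [Finite β], Nat.card β < Nat.card α → Good p β)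
    (G : Subgroup (Perm α)) (hG : ¬ p ∣ Nat.card G) [MulAction.IsPretransitive G α]
    (h : ¬ MulAction.IsPreprimitive G α) :
    Nat.card G * p ^ kk G < p ^ Nat.card α := by
  obtain ⟨r, hr, ⟨x, y, hxy, rxy⟩, a, b, hab⟩ := exists_setoid h
  have hr' : ∀ h ∈ G, ∀ x y, r x y → r (h x) (h y) := fun h hh x y => hr ⟨h, hh⟩ x y
  have : Nonempty α := ⟨x⟩
  set φ := quoHom G r hr' with hφ
  set N := kerP φ
  have hN : Nat.card N * p ^ kk N ≤ p ^ Nat.card α := by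
    by_cases hb : N = ⊥
    · rw [hb, kk_bot]; simp
    · refine (intrans hp IH N (kerP_ndvd φ hG) hb {z | r a z} ?_ ⟨a, r.refl a⟩ ⟨b, hab⟩).le
      intro g hg z
      obtain ⟨h, e⟩ := (mem_kerP _ _).1 hg
      have := congrArg (fun f : Perm (Quotient r) => f (Quotient.mk r z)) e
      have hz : r (g z) z := Quotient.exact this
      exact ⟨fun h => r.trans h hz, fun h => r.trans h (r.symm hz)⟩
  have hQ := IH (Quotient r) (card_quo_lt r x y hxy rxy)
  have hk : Nat.card (Quotient r) ≤ kk N := card_quo_le_kk G r hr'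
  have hnb : φ.range ≠ ⊥ := by
    intro hb
    apply hab
    obtain ⟨g, hg⟩ := MulAction.exists_smul_eq G a b
    have h1 : φ g = 1 := by
      rw [← Subgroup.mem_bot, ← hb]; exact ⟨g, rfl⟩
    have := congrArg (fun f : Perm (Quotient r) => f (Quotient.mk r a)) h1
    have h2 : r (g • a) a := Quotient.exact this
    rw [hg] at h2
    exact r.symm h2
  have h3 := hQ φ.range (range_ndvd φ hG) hnb
  have h4 : 0 < kk φ.range := by
    have : Nonempty (Quotient r) := ⟨Quotient.mk _ x⟩
    exact kk_pos _
  rw [kk_trans G inferInstance, card_split φ]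
  have h5 : Nat.card φ.range * p ^ 1 < p ^ Nat.card (Quotient r) :=
    lt_of_le_of_lt (Nat.mul_le_mul_left _ (Nat.pow_le_pow_right hp.pos h4)) h3
  have h6 : Nat.card N * p ^ Nat.card (Quotient r) ≤ p ^ Nat.card α :=
    le_trans (Nat.mul_le_mul_left _ (Nat.pow_le_pow_right hp.pos hk)) hN
  have h7 : 0 < Nat.card N := Nat.card_pos
  calc Nat.card N * Nat.card φ.range * p ^ 1 = Nat.card N * (Nat.card φ.range * p ^ 1) := by ring
    _ < Nat.card N * p ^ Nat.card (Quotient r) := by gcongr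
    _ ≤ _ := h6

end PG

open Equiv
open scoped Pointwise

namespace PG

lemma count_quo {α Q : Type*} [Fintype α] [Fintype Q] [DecidableEq Q] (f : α → Q) (w : α → ℕ)
    (c : Q → ℕ)
    (h : ∀ q, 2 + ∑ x ∈ Finset.univ.filter (fun x => f x = q), w x
      ≤ 2 * (Finset.univ.filter (fun x => f x = q)).card + c q) :
    2 * Fintype.card Q + ∑ x, w x ≤ 2 * Fintype.card α + ∑ q, c q := by
  have h1 := Finset.sum_le_sum (fun q (_ : q ∈ Finset.univ) => h q)
  rw [Finset.sum_add_distrib, Finset.sum_add_distrib, ← Finset.mul_sum,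
    Finset.sum_fiberwise] at h1
  have h2 : ∑ q : Q, (Finset.univ.filter (fun x => f x = q)).card = Fintype.card α := by
    rw [← Finset.card_univ]
    exact (Finset.card_eq_sum_card_fiberwise (fun x _ => Finset.mem_univ (f x))).symm
  rw [h2] at h1
  simpa [mul_comm] using h1

lemma lemU {α : Type} [Finite α] {p : ℕ} (hp : p.Prime)
    (IH : ∀ (β : Type) [Finite β], Nat.card β < Nat.card α → Good p β)
    (H : Subgroup (Perm α)) (hH : ¬ p ∣ Nat.card H)
    (hmax : ∀ N ≤ H, N ≠ ⊥ → kk H ≤ kk N → Nat.card N * p ^ kk N ≤ Nat.card H * p ^ kk H)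
    (r : Setoid α) (hr : ∀ h ∈ H, ∀ x y, r x y → r (h x) (h y))
    (hle : ∀ x y, r x y → (orb H) x y) (x y : α) (hxy : x ≠ y) (rxy : r x y)
    (a b : α) (hab : (orb H) a b) (hnab : ¬ r a b) :
    Nat.card H * p ^ kk H < p ^ Nat.card (Quotient r) := by
  set φ := quoHom H r hr with hφ
  have hnb : φ.range ≠ ⊥ := by
    intro hb
    apply hnab
    obtain ⟨g, hg, e⟩ := hab
    have h1 : φ ⟨g, hg⟩ = 1 := by
      rw [← Subgroup.mem_bot, ← hb]; exact ⟨_, rfl⟩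
    have := congrArg (fun f : Perm (Quotient r) => f (Quotient.mk r a)) h1
    have h2 : r (g a) a := Quotient.exact this
    rw [e] at h2
    exact r.symm h2
  have h3 := IH (Quotient r) (card_quo_lt r x y hxy rxy) φ.range (range_ndvd φ hH) hnb
  have h4 : kk H ≤ kk φ.range := kk_le_kk_quo H r hr hle
  have h5 : Nat.card φ.range * p ^ kk H < p ^ Nat.card (Quotient r) :=
    lt_of_le_of_lt (Nat.mul_le_mul_left _ (Nat.pow_le_pow_right hp.pos h4)) h3
  have hc := card_split φ
  by_cases hN : kerP φ = ⊥
  · rw [hc, hN]; simpa using h5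
  · exfalso
    have h6 := hmax _ (kerP_le φ) hN (kk_mono (kerP_le φ))
    have h7 : Nat.card (Quotient r) ≤ kk (kerP φ) := card_quo_le_kk H r hr
    have h8 : 0 < Nat.card (kerP φ) := Nat.card_pos
    have : Nat.card H * p ^ kk H < Nat.card (kerP φ) * p ^ kk (kerP φ) := by
      calc Nat.card H * p ^ kk H = Nat.card (kerP φ) * (Nat.card φ.range * p ^ kk H) := by
            rw [hc]; ring
        _ < Nat.card (kerP φ) * p ^ Nat.card (Quotient r) := by gcongr
        _ ≤ _ := Nat.mul_le_mul_left _ (Nat.pow_le_pow_right hp.pos h7)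
    omega

/-- case (i) -/
lemma case_two {α : Type} [Fintype α] [DecidableEq α] (H : Subgroup (Perm α))
    (x0 x1 : α) (h0 : ∃ h ∈ H, h x0 ≠ x0) (h1 : ∃ h ∈ H, h x1 ≠ x1) (h01 : ¬ (orb H) x0 x1)
    (hcard : {z | (orb H) x0 z}.ncard ≤ {z | (orb H) x1 z}.ncard) :
    ∃ r : Setoid α, (∀ h ∈ H, ∀ x y, r x y → r (h x) (h y)) ∧
      (∀ x y, r x y → (orb H) x y) ∧ (∃ x y, x ≠ y ∧ r x y) ∧
      (∃ a b, (orb H) a b ∧ ¬ r a b) ∧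
      2 * Nat.card (Quotient r) + {x | ∃ h ∈ H, h x ≠ x}.ncard ≤ 2 * Nat.card α + 2 := by
  classical
  have ho : ∀ h ∈ H, ∀ x, (orb H) x (h x) := fun h hh x => ⟨h, hh, rfl⟩
  let r : Setoid α := ⟨fun x y => x = y ∨ ((orb H) x y ∧ ¬ (orb H) x0 x),
    fun x => Or.inl rfl, by
      rintro x y (h | ⟨h, h'⟩)
      · exact Or.inl h.symm
      · exact Or.inr ⟨(orb H).symm h, fun h2 => h' ((orb H).trans h2 ((orb H).symm h))⟩, by
      rintro x y z (rfl | ⟨h, h'⟩)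
      · exact id
      · rintro (rfl | ⟨h2, h3⟩)
        · exact Or.inr ⟨h, h'⟩
        · exact Or.inr ⟨(orb H).trans h h2, h'⟩⟩
  have rdef : ∀ x y, r x y ↔ (x = y ∨ ((orb H) x y ∧ ¬ (orb H) x0 x)) := fun x y => Iff.rfl
  refine ⟨r, ?_, ?_, ?_, ?_, ?_⟩
  · rintro h hh x y (rfl | ⟨h2, h3⟩)
    · exact Or.inl rfl
    · refine Or.inr ⟨(orb H).trans ((orb H).symm (ho h hh x)) ((orb H).trans h2 (ho h hh y)), ?_⟩
      intro h4
      exact h3 ((orb H).trans h4 ((orb H).symm (ho h hh x)))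
  · rintro x y (rfl | h)
    · exact (orb H).refl x
    · exact h.1
  · obtain ⟨h, hh, hne⟩ := h1
    exact ⟨x1, h x1, hne.symm, Or.inr ⟨ho h hh x1, h01⟩⟩
  · obtain ⟨h, hh, hne⟩ := h0
    refine ⟨x0, h x0, ho h hh x0, ?_⟩
    rw [rdef]
    rintro (h | ⟨_, h⟩)
    · exact hne h.symm
    · exact h ((orb H).refl x0)
  · have : Fintype (Quotient r) := Fintype.ofFinite _
    rw [Nat.card_eq_fintype_card, Nat.card_eq_fintype_card]
    let Mv : Finset α := Finset.univ.filter (fun x => ∃ h ∈ H, h x ≠ x)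
    let L0 : Finset α := Finset.univ.filter (fun x => (orb H) x0 x)
    let L1 : Finset α := Finset.univ.filter (fun x => (orb H) x1 x)
    have e0 : {z | (orb H) x0 z}.ncard = L0.card := by
      rw [← Set.ncard_coe_finset]; simp [L0]
    have e1 : {z | (orb H) x1 z}.ncard = L1.card := by
      rw [← Set.ncard_coe_finset]; simp [L1]
    have eM : {x | ∃ h ∈ H, h x ≠ x}.ncard = Mv.card := by
      rw [← Set.ncard_coe_finset]; simp [Mv]
    rw [e0, e1] at hcard
    rw [eM]
    have hmv : ∀ x y, (orb H) x y → x ∈ Mv → y ∈ Mv := by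
      rintro x y ⟨h, hh, rfl⟩ hx
      obtain ⟨k, hk, hne⟩ := (Finset.mem_filter.1 hx).2
      refine Finset.mem_filter.2 ⟨Finset.mem_univ _, h * k * h⁻¹, 
        H.mul_mem (H.mul_mem hh hk) (H.inv_mem hh), ?_⟩
      simpa using hne
    have hL1M : L1 ⊆ Mv := by
      intro y hy
      exact hmv x1 y (Finset.mem_filter.1 hy).2 (Finset.mem_filter.2 ⟨Finset.mem_univ _, h1⟩)
    have key := count_quo (Quotient.mk r)
      (fun x => (if x ∈ Mv \ L0 then 1 else 0) + (if x ∈ L1 then 1 else 0))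
      (fun q => if q = Quotient.mk r x1 then 2 else 0) ?_
    · simp only [Finset.sum_add_distrib, Finset.sum_ite_mem, Finset.univ_inter, Finset.sum_const,
        smul_eq_mul, mul_one, Finset.sum_ite_eq', Finset.mem_univ, if_true] at key
      have : Mv.card ≤ (Mv \ L0).card + L0.card := by
        have := Finset.card_le_card_sdiff_add_card (s := Mv) (t := L0)
        omega
      omega
    · intro q
      induction q using Quotient.inductionOn with | _ x
      set F := Finset.univ.filter (fun y => Quotient.mk r y = Quotient.mk r x) with hF
      have memF : ∀ y, y ∈ F ↔ r y x := by
        intro y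
        simp only [hF, Finset.mem_filter, Finset.mem_univ, true_and]
        exact Quotient.eq
      have hxF : x ∈ F := (memF x).2 (r.refl x)
      have hFpos : 1 ≤ F.card := Finset.card_pos.2 ⟨x, hxF⟩
      by_cases hx1 : (orb H) x1 x
      · have : Quotient.mk r x = Quotient.mk r x1 := by
          apply Quotient.sound
          exact r.symm (Or.inr ⟨hx1, h01⟩)
        rw [if_pos this]
        have : ∑ y ∈ F, ((if y ∈ Mv \ L0 then 1 else 0) + (if y ∈ L1 then 1 else 0)) ≤ 
            ∑ y ∈ F, 2 := Finset.sum_le_sum (fun y _ => by split_ifs <;> omega)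
        simp only [Finset.sum_const, smul_eq_mul] at this
        omega
      · have hFL1 : ∀ y ∈ F, y ∉ L1 := by
          intro y hy hy1
          rcases (memF y).1 hy with h | h
          · subst h; exact hx1 (Finset.mem_filter.1 hy1).2
          · exact hx1 ((orb H).trans (Finset.mem_filter.1 hy1).2 h.1)
        have hs : ∑ y ∈ F, ((if y ∈ Mv \ L0 then 1 else 0) + (if y ∈ L1 then 1 else 0)) = 
            ∑ y ∈ F, (if y ∈ Mv \ L0 then 1 else 0) :=
          Finset.sum_congr rfl (fun y hy => by rw [if_neg (hFL1 y hy), add_zero])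
        rw [hs]
        by_cases hxM : x ∈ Mv \ L0
        · have hle : ∑ y ∈ F, (if y ∈ Mv \ L0 then 1 else 0) ≤ ∑ y ∈ F, 1 :=
            Finset.sum_le_sum (fun y _ => by split_ifs <;> omega)
          rw [Finset.mem_sdiff] at hxM
          have hx0 : ¬ (orb H) x0 x := fun h => hxM.2 (Finset.mem_filter.2 ⟨Finset.mem_univ _, h⟩)
          obtain ⟨h, hh, hne⟩ := (Finset.mem_filter.1 hxM.1).2
          have : 2 ≤ F.card := by
            have h2 : 1 < F.card := Finset.one_lt_card.2 ⟨x, hxF, h x, 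
              (memF _).2 (r.symm (Or.inr ⟨ho h hh x, hx0⟩)), hne.symm⟩
            omega
          simp only [Finset.sum_const, smul_eq_mul] at hle
          omega
        · have : ∀ y ∈ F, y ∉ Mv \ L0 := by
            intro y hy hyM
            rcases (memF y).1 hy with h | h
            · subst h; exact hxM hyM
            · apply hxM
              rw [Finset.mem_sdiff] at hyM ⊢
              refine ⟨hmv _ _ h.1 hyM.1, fun hx0 => h.2 ?_⟩
              exact (orb H).trans (Finset.mem_filter.1 hx0).2 ((orb H).symm h.1)
          rw [Finset.sum_eq_zero (fun y hy => if_neg (this y hy))]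
          omega

/-- case (ii)/(iii) -/
lemma case_one {α : Type} [Fintype α] [DecidableEq α] (G H : Subgroup (Perm α)) (hHG : H ≤ G)
    (hprim : MulAction.IsPreprimitive G α) (t : ℕ) (ht : 1 ≤ t)
    (hnt : ¬ MulAction.IsMultiplyPretransitive G α (t + 1)) (hk : t + 1 ≤ kk H)
    (x0 : α) (h0 : ∃ h ∈ H, h x0 ≠ x0)
    (hone : ∀ x1, (∃ h ∈ H, h x1 ≠ x1) → (orb H) x0 x1) :
    ∃ r : Setoid α, (∀ h ∈ H, ∀ x y, r x y → r (h x) (h y)) ∧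
      (∀ x y, r x y → (orb H) x y) ∧ (∃ x y, x ≠ y ∧ r x y) ∧
      (∃ a b, (orb H) a b ∧ ¬ r a b) ∧
      2 * Nat.card (Quotient r) + {x | ∃ h ∈ H, h x ≠ x}.ncard ≤ 2 * Nat.card α + 2 := by
  classical
  have ho : ∀ h ∈ H, ∀ x, (orb H) x (h x) := fun h hh x => ⟨h, hh, rfl⟩
  let s : Set α := {x | ∀ h ∈ H, h x = x}
  have hsc : ∀ x, x ∉ s ↔ ∃ h ∈ H, h x ≠ x := by
    intro x; simp [s]
  let K := fixingSubgroup G s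
  let Ω := SubMulAction.ofFixingSubgroup G s
  have hΩ : ∀ x, x ∈ Ω ↔ x ∉ s := fun x => Iff.rfl
  have hHK : ∀ h (hh : h ∈ H), (⟨h, hHG hh⟩ : G) ∈ K := by
    intro h hh
    rw [mem_fixingSubgroup_iff]
    intro y hy
    exact hy h hh
  have horb : ∀ x y, x ∉ s → y ∉ s → (orb H) x y := fun x y hx hy =>
    (orb H).trans ((orb H).symm (hone x ((hsc x).1 hx))) (hone y ((hsc y).1 hy))
  have hKt : MulAction.IsPretransitive K Ω := by
    constructor
    rintro ⟨x, hx⟩ ⟨y, hy⟩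
    obtain ⟨h, hh, e⟩ := horb x y hx hy
    exact ⟨⟨⟨h, hHG hh⟩, hHK h hh⟩, Subtype.ext e⟩
  have hsn : t ≤ s.ncard := by
    have : kk H ≤ s.ncard + 1 := by
      have e : s.ncard + 1 = Nat.card (Option s) := by
        rw [Finite.card_option]; rfl
      rw [e]
      apply Nat.card_le_card_of_surjective (fun o : Option s => 
        (Quotient.mk (orb H) (o.elim x0 (fun x => (x : α)))))
      intro q
      induction q using Quotient.inductionOn with | _ x
      by_cases hx : x ∈ s
      · exact ⟨some ⟨x, hx⟩, rfl⟩
      · exact ⟨none, Quotient.sound (hone x ((hsc x).1 hx))⟩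
    omega
  have hs2 : s.ncard + 2 ≤ Nat.card α := by
    obtain ⟨h, hh, hne⟩ := h0
    have h1 : x0 ∉ s := (hsc _).2 ⟨h, hh, hne⟩
    have h2 : h x0 ∉ s := by
      refine (hsc _).2 ⟨h, hh, fun e => hne (h.injective e)⟩
    have h3 := Set.ncard_add_ncard_compl s
    have h4 : 1 < sᶜ.ncard := (Set.one_lt_ncard).2 ⟨x0, h1, h x0, h2, hne.symm⟩
    omega
  have hnp : ¬ MulAction.IsPreprimitive K Ω := by
    intro hp
    apply hnt
    obtain ⟨m, hm⟩ : ∃ m, s.ncard = m + 1 := ⟨s.ncard - 1, by omega⟩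
    have := hprim.isMultiplyPreprimitive hm (by omega) hp
    have h2 : MulAction.IsMultiplyPretransitive G α (m + 2) := this.isMultiplyPretransitive
    apply MulAction.isMultiplyPretransitive_of_le' (n := m + 2) (by omega)
    rw [ENat.card_eq_coe_natCard]
    exact_mod_cast (by omega : m + 2 ≤ Nat.card α)
  obtain ⟨r, hr, ⟨⟨x, hx⟩, ⟨y, hy⟩, hxy, rxy⟩, ⟨a, ha⟩, ⟨b, hb⟩, hab⟩ := exists_setoid hnp
  let r' : Setoid α := ⟨fun x y => x = y ∨ ∃ (hx : x ∈ Ω) (hy : y ∈ Ω), r ⟨x, hx⟩ ⟨y, hy⟩,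
    fun x => Or.inl rfl, by
      rintro x y (h | ⟨hx, hy, h⟩)
      · exact Or.inl h.symm
      · exact Or.inr ⟨hy, hx, r.symm h⟩, by
      rintro x y z (rfl | ⟨hx, hy, h⟩)
      · exact id
      · rintro (rfl | ⟨hy', hz, h'⟩)
        · exact Or.inr ⟨hx, hy, h⟩
        · exact Or.inr ⟨hx, hz, r.trans h h'⟩⟩
  have hrH : ∀ h ∈ H, ∀ x y, r' x y → r' (h x) (h y) := by
    rintro h hh x y (rfl | ⟨hx, hy, hxy⟩)
    · exact Or.inl rfl
    · exact Or.inr ⟨_, _, hr ⟨⟨h, hHG hh⟩, hHK h hh⟩ _ _ hxy⟩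
  refine ⟨r', hrH, ?_, ⟨x, y, fun e => hxy (Subtype.ext e), Or.inr ⟨hx, hy, rxy⟩⟩,
    ⟨a, b, horb a b ha hb, ?_⟩, ?_⟩
  · rintro x y (rfl | ⟨hx, hy, _⟩)
    · exact (orb H).refl x
    · exact horb x y hx hy
  · rintro (rfl | ⟨_, _, h⟩)
    · exact hab (r.refl _)
    · exact hab h
  · have : Fintype (Quotient r') := Fintype.ofFinite _
    rw [Nat.card_eq_fintype_card, Nat.card_eq_fintype_card]
    let Mv : Finset α := Finset.univ.filter (fun x => ∃ h ∈ H, h x ≠ x)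
    have eM : {x | ∃ h ∈ H, h x ≠ x}.ncard = Mv.card := by
      rw [← Set.ncard_coe_finset]; simp [Mv]
    rw [eM]
    have key := count_quo (Quotient.mk r')
      (fun x => (if x ∈ Mv then 1 else 0)) (fun q => 0) ?_
    · simp only [Finset.sum_ite_mem, Finset.univ_inter, Finset.sum_const,
        smul_eq_mul, mul_one, mul_zero] at key
      omega
    · intro q
      induction q using Quotient.inductionOn with | _ z
      set F := Finset.univ.filter (fun y => Quotient.mk r' y = Quotient.mk r' z) with hF
      have memF : ∀ y, y ∈ F ↔ r' y z := by
        intro y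
        simp only [hF, Finset.mem_filter, Finset.mem_univ, true_and]
        exact Quotient.eq
      have hzF : z ∈ F := (memF z).2 (r'.refl z)
      have hFpos : 1 ≤ F.card := Finset.card_pos.2 ⟨z, hzF⟩
      by_cases hz : z ∈ s
      · have : ∀ y ∈ F, y ∉ Mv := by
          intro y hy hyM
          rcases (memF y).1 hy with h | ⟨_, h, _⟩
          · subst h; exact (hsc y).2 (Finset.mem_filter.1 hyM).2 hz
          · exact h hz
        rw [Finset.sum_eq_zero (fun y hy => if_neg (this y hy))]
        omega
      · have hle : ∑ y ∈ F, (if y ∈ Mv then 1 else 0) ≤ ∑ y ∈ F, 1 :=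
            Finset.sum_le_sum (fun y _ => by split_ifs <;> omega)
        obtain ⟨h, hh, e⟩ := horb x z hx hz
        have h1 : r' z (h y) := by
          rw [← e]; exact hrH h hh x y (Or.inr ⟨hx, hy, rxy⟩)
        have h2 : z ≠ h y := by
          rw [← e]; exact fun e' => hxy (Subtype.ext (h.injective e'))
        have : 1 < F.card := Finset.one_lt_card.2 ⟨z, hzF, h y, (memF _).2 (r'.symm h1), h2⟩
        simp only [Finset.sum_const, smul_eq_mul] at hle
        omega

lemma key_lemma {α : Type} [Fintype α] [DecidableEq α] {p : ℕ} (hp : p.Prime)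
    (IH : ∀ (β : Type) [Finite β], Nat.card β < Nat.card α → Good p β)
    (G : Subgroup (Perm α)) (hG : ¬ p ∣ Nat.card G)
    (hprim : MulAction.IsPreprimitive G α) (t : ℕ) (ht : 1 ≤ t)
    (hnt : ¬ MulAction.IsMultiplyPretransitive G α (t + 1))
    (H0 : Subgroup (Perm α)) (h0G : H0 ≤ G) (h0b : H0 ≠ ⊥) (hk0 : t + 1 ≤ kk H0) :
    ∃ g ∈ G, g ≠ 1 ∧
      (Nat.card H0 * p ^ kk H0) ^ 2 * p ^ g.support.card < p ^ (2 * Nat.card α + 2) := by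
  classical
  obtain ⟨H, ⟨hHG, hHb, hkH⟩, hmax⟩ := Set.exists_max_image
    {H : Subgroup (Perm α) | H ≤ G ∧ H ≠ ⊥ ∧ t + 1 ≤ kk H} (fun H => Nat.card H * p ^ kk H)
    (Set.toFinite _) ⟨H0, h0G, h0b, hk0⟩
  have hle := hmax H0 ⟨h0G, h0b, hk0⟩
  have hH : ¬ p ∣ Nat.card H := fun h => hG (h.trans (Subgroup.card_dvd_of_le hHG))
  obtain ⟨⟨h, hh⟩, hne'⟩ := Subgroup.ne_bot_iff_exists_ne_one.1 hHb
  have hne : h ≠ 1 := fun e => hne' (Subtype.ext e)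
  obtain ⟨x0, hx0⟩ : ∃ x, h x ≠ x := by
    by_contra hc; push Not at hc; exact hne (Equiv.ext hc)
  have hr : ∃ r : Setoid α, (∀ h ∈ H, ∀ x y, r x y → r (h x) (h y)) ∧
      (∀ x y, r x y → (orb H) x y) ∧ (∃ x y, x ≠ y ∧ r x y) ∧
      (∃ a b, (orb H) a b ∧ ¬ r a b) ∧
      2 * Nat.card (Quotient r) + {x | ∃ h ∈ H, h x ≠ x}.ncard ≤ 2 * Nat.card α + 2 := by
    by_cases hone : ∀ x1, (∃ h ∈ H, h x1 ≠ x1) → (orb H) x0 x1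
    · exact case_one G H hHG hprim t ht hnt hkH x0 ⟨h, hh, hx0⟩ hone
    · push Not at hone
      obtain ⟨x1, hx1, h01⟩ := hone
      rcases le_total {z | (orb H) x0 z}.ncard {z | (orb H) x1 z}.ncard with hc | hc
      · exact case_two H x0 x1 ⟨h, hh, hx0⟩ hx1 h01 hc
      · exact case_two H x1 x0 hx1 ⟨h, hh, hx0⟩ (fun h => h01 ((orb H).symm h)) hc
  obtain ⟨r, r1, r2, ⟨x, y, hxy, rxy⟩, ⟨a, b, hab, nab⟩, hcount⟩ := hr
  have hlt := lemU hp IH H hH (fun N hN hNb hkN => hmax N ⟨hN.trans hHG, hNb, hkH.trans hkN⟩)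
    r r1 r2 x y hxy rxy a b hab nab
  refine ⟨h, hHG hh, hne, ?_⟩
  have hsup : h.support.card ≤ {x | ∃ h ∈ H, h x ≠ x}.ncard := by
    rw [← Set.ncard_coe_finset]
    apply Set.ncard_le_ncard _ (Set.toFinite _)
    intro z hz
    exact ⟨h, hh, by simpa using hz⟩
  calc (Nat.card H0 * p ^ kk H0) ^ 2 * p ^ h.support.card
      ≤ (Nat.card H * p ^ kk H) ^ 2 * p ^ h.support.card := by gcongr
    _ < (p ^ Nat.card (Quotient r)) ^ 2 * p ^ h.support.card := by
      have := pow_pos hp.pos h.support.card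
      gcongr
    _ = p ^ (2 * Nat.card (Quotient r) + h.support.card) := by ring
    _ ≤ _ := Nat.pow_le_pow_right hp.pos (by omega)

end PG

open Equiv
open scoped Pointwise

namespace PG

/-- pointwise stabilizer of a tuple -/
def ptw {α ι : Type*} (G : Subgroup (Perm α)) (x : ι → α) : Subgroup (Perm α) where
  carrier := {g | g ∈ G ∧ ∀ i, g (x i) = x i}
  one_mem' := ⟨G.one_mem, fun _ => rfl⟩
  mul_mem' := fun {a b} ha hb => ⟨G.mul_mem ha.1 hb.1, fun i => by simp [ha.2, hb.2]⟩
  inv_mem' := fun {a} ha => ⟨G.inv_mem ha.1, fun i => by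
    rw [Perm.inv_eq_iff_eq]; exact (ha.2 i).symm⟩

lemma mem_ptw {α ι : Type*} {G : Subgroup (Perm α)} {x : ι → α} {g : Perm α} :
    g ∈ ptw G x ↔ g ∈ G ∧ ∀ i, g (x i) = x i := Iff.rfl

lemma ptw_le {α ι : Type*} {G : Subgroup (Perm α)} {x : ι → α} : ptw G x ≤ G := fun _ h => h.1

lemma ptw_eq {α ι : Type*} {G : Subgroup (Perm α)} (x : ι ↪ α) :
    ptw G x = (MulAction.stabilizer G x).map G.subtype := by
  ext g
  simp only [mem_ptw, Subgroup.mem_map, MulAction.mem_stabilizer_iff, Subgroup.coe_subtype,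
    Subtype.exists, exists_and_right, exists_eq_right]
  constructor
  · rintro ⟨h, h2⟩
    exact ⟨h, by ext i; exact h2 i⟩
  · rintro ⟨h, h2⟩
    refine ⟨h, fun i => ?_⟩
    have := congrArg (fun f : ι ↪ α => f i) h2
    exact this

lemma card_ptw {α ι : Type*} {G : Subgroup (Perm α)} (x : ι ↪ α) :
    Nat.card (ptw G x) = Nat.card (MulAction.stabilizer G x) := by
  rw [ptw_eq]
  exact (Nat.card_congr ((MulAction.stabilizer G x).equivMapOfInjective _
    G.subtype_injective).toEquiv).symm

lemma card_ptw_mul {α : Type*} [Finite α] {G : Subgroup (Perm α)} {t : ℕ}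
    (h : MulAction.IsMultiplyPretransitive G α t) (x : Fin t ↪ α) :
    Nat.card G = Nat.card (ptw G x) * (Nat.card α).descFactorial t := by
  have := Fintype.ofFinite α
  have : MulAction.IsPretransitive G (Fin t ↪ α) := h
  have h1 := @MulAction.index_stabilizer_of_transitive G (Fin t ↪ α) _ _ x h
  rw [card_ptw, ← Subgroup.card_mul_index (MulAction.stabilizer G x), h1]
  simp [Nat.card_eq_fintype_card]

lemma trans_fun {α ι : Type*} [Finite ι] {G : Subgroup (Perm α)} {t : ℕ} (hι : Nat.card ι = t)
    (h : MulAction.IsMultiplyPretransitive G α t) (x y : ι → α) (hx : Function.Injective x)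
    (hy : Function.Injective y) : ∃ g ∈ G, ∀ i, g (x i) = y i := by
  let e : ι ≃ Fin t := Finite.equivFinOfCardEq hι
  obtain ⟨g, hg⟩ := h.exists_smul_eq (e.symm.toEmbedding.trans ⟨x, hx⟩)
    (e.symm.toEmbedding.trans ⟨y, hy⟩)
  refine ⟨g, g.2, fun i => ?_⟩
  have := congrArg (fun f : Fin t ↪ α => f (e i)) hg
  simp at this
  exact this

lemma kk_ge {α ι J : Type*} [Finite α] [Finite ι] [Finite J] (H : Subgroup (Perm α))
    (y : ι → α) (hy : Function.Injective y)
    (hH : ∀ h ∈ H, ∀ i, h (y i) = y i) (a : J → α) (ha : ∀ j i, a j ≠ y i)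
    (hinj : ∀ i j, (orb H) (a i) (a j) → i = j) : Nat.card ι + Nat.card J ≤ kk H := by
  unfold kk
  rw [← Nat.card_sum]
  apply Nat.card_le_card_of_injective (fun s : ι ⊕ J => Quotient.mk (orb H) (Sum.elim y a s))
  rintro (i | i) (j | j) e
  · obtain ⟨h, hh, e⟩ := Quotient.exact e
    simp only [Sum.elim_inl] at e
    rw [hH h hh] at e
    rw [hy e]
  · obtain ⟨h, hh, e⟩ := Quotient.exact e
    simp only [Sum.elim_inl, Sum.elim_inr] at e
    rw [hH h hh] at e
    exact absurd e.symm (ha _ _)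
  · obtain ⟨h, hh, e⟩ := Quotient.exact e.symm
    simp only [Sum.elim_inl, Sum.elim_inr] at e
    rw [hH h hh] at e
    exact absurd e.symm (ha _ _)
  · rw [hinj _ _ (Quotient.exact e)]

lemma not_p_trans {α : Type*} [Finite α] {p : ℕ} (hp : p.Prime) (G : Subgroup (Perm α))
    (hG : ¬ p ∣ Nat.card G) (hpn : p ≤ Nat.card α) :
    ¬ MulAction.IsMultiplyPretransitive G α p := by
  intro h
  have := Fintype.ofFinite α
  obtain ⟨x⟩ : Nonempty (Fin p ↪ α) := by
    rw [Function.Embedding.nonempty_iff_card_le]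
    rw [Fintype.card_fin, ← Nat.card_eq_fintype_card]; exact hpn
  apply hG
  rw [card_ptw_mul h x]
  refine Dvd.dvd.mul_left (Dvd.dvd.trans ?_ (Nat.factorial_dvd_descFactorial _ _)) _
  exact (hp.dvd_factorial).2 le_rfl

/-- not (t+1)-transitive: two orbits outside. -/
lemma kk_two {α : Type*} [Finite α] (G : Subgroup (Perm α)) (t : ℕ)
    (h : MulAction.IsMultiplyPretransitive G α t)
    (hn : ¬ MulAction.IsMultiplyPretransitive G α (t + 1)) (x : Fin t ↪ α) :
    t + 2 ≤ kk (ptw G x) := by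
  by_cases hc : ∃ a b, (∀ i, a ≠ x i) ∧ (∀ i, b ≠ x i) ∧ ¬ (orb (ptw G x)) a b
  · obtain ⟨a, b, ha, hb, hab⟩ := hc
    have := kk_ge (ptw G x) x x.injective (fun h hh => hh.2) ![a, b] ?_ ?_
    · simpa using this
    · intro j i; fin_cases j
      · exact ha i
      · exact hb i
    · intro i j hij
      fin_cases i <;> fin_cases j
      · rfl
      · exact absurd hij hab
      · exact absurd ((orb _).symm hij) hab
      · rfl
  · exfalso
    push Not at hc
    apply hn
    have key : ∀ y : Fin (t + 1) ↪ α, ∃ g ∈ G, (∀ i : Fin t, g (y i.castSucc) = x i) := by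
      intro y
      exact trans_fun (by simp) h (fun i : Fin t => y i.castSucc) x
        (fun i j e => Fin.castSucc_injective _ (y.injective e)) x.injective
    constructor
    intro y z
    obtain ⟨g, hg, hgy⟩ := key y
    obtain ⟨k, hk, hkz⟩ := key z
    have := hc (g (y (Fin.last t))) (k (z (Fin.last t))) ?_ ?_
    · obtain ⟨m, hm, e⟩ := this
      refine ⟨⟨k⁻¹ * m * g, G.mul_mem (G.mul_mem (G.inv_mem hk) hm.1) hg⟩, ?_⟩
      ext i
      show k⁻¹ (m (g (y i))) = z i
      rw [Perm.inv_eq_iff_eq]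
      induction i using Fin.lastCases with
      | last => exact e
      | cast i => rw [hgy, hkz, hm.2]
    · intro i e
      rw [← hgy] at e
      exact (Fin.castSucc_lt_last i).ne' (y.injective (g.injective e))
    · intro i e
      rw [← hkz] at e
      exact (Fin.castSucc_lt_last i).ne' (z.injective (k.injective e))

lemma rot_ne {α : Type*} [Finite α] {p : ℕ} (hp : p.Prime) (G : Subgroup (Perm α))
    (hG : ¬ p ∣ Nat.card G) (x : ZMod p → α) (hx : Function.Injective x) (g : Perm α) (hg : g ∈ G)
    (k : ZMod p) (h : ∀ i, g (x i) = x (i + k)) : k = 0 := by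
  have := Fact.mk hp
  have h1 : ∀ m : ℕ, ∀ i, (g ^ m) (x i) = x (i + m * k) := by
    intro m
    induction m with
    | zero => intro i; simp
    | succ m ih => intro i; rw [pow_succ']; simp only [Perm.mul_apply, ih, h]; push_cast; ring_nf
  have h2 := h1 (Nat.card G) 0
  have h3 : g ^ Nat.card G = 1 := by
    have := pow_card_eq_one' (x := (⟨g, hg⟩ : G))
    exact congrArg Subtype.val this
  rw [h3] at h2
  have h4 := hx h2
  simp only [zero_add] at h4
  rcases mul_eq_zero.1 h4.symm with h5 | h5
  · exact absurd ((ZMod.natCast_eq_zero_iff _ _).1 h5) hG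
  · exact h5

lemma kk_p {α : Type*} [Finite α] {p : ℕ} (hp : p.Prime) (G : Subgroup (Perm α))
    (hG : ¬ p ∣ Nat.card G) (hpn : p ≤ Nat.card α)
    (h : MulAction.IsMultiplyPretransitive G α (p - 1)) (x : Fin (p - 1) ↪ α) :
    (p - 1) + p ≤ kk (ptw G x) := by
  classical
  have := Fact.mk hp
  have := Fintype.ofFinite α
  obtain ⟨w⟩ : Nonempty (ZMod p ↪ α) := by
    rw [Function.Embedding.nonempty_iff_card_le]
    simpa [← Nat.card_eq_fintype_card] using hpn
  have hcard : Nat.card {i : ZMod p // i ≠ 0} = p - 1 := by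
    rw [Nat.card_eq_fintype_card]
    simp [Fintype.card_subtype_compl, ZMod.card]
  let e : {i : ZMod p // i ≠ 0} ≃ Fin (p - 1) := Finite.equivFinOfCardEq hcard
  have key : ∀ j : ZMod p, ∃ g ∈ G, ∀ i : {i : ZMod p // i ≠ 0}, g (w (i + j)) = x (e i) := by
    intro j
    exact trans_fun hcard h (fun i : {i : ZMod p // i ≠ 0} => w (i + j)) (fun i => x (e i))
      (fun a b hab => Subtype.ext (add_right_cancel (w.injective hab)))
      (x.injective.comp e.injective)
  choose g hgG hg using key
  have := kk_ge (ptw G x) x x.injective (fun h hh => hh.2) (fun j : ZMod p => g j (w j)) ?_ ?_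
  · simpa using this
  · intro j i hc
    have := hg j (e.symm i)
    rw [e.apply_symm_apply, ← hc] at this
    have h2 := w.injective ((g j).injective this)
    exact (e.symm i).2 (by simpa using h2)
  · rintro i j ⟨m, hm, em⟩
    have := rot_ne hp G hG w w.injective ((g j)⁻¹ * m * g i)
      (G.mul_mem (G.mul_mem (G.inv_mem (hgG j)) hm.1) (hgG i)) (j - i) ?_
    · exact (sub_eq_zero.1 this).symm
    · intro l
      simp only [Perm.mul_apply]
      rw [Perm.inv_eq_iff_eq]
      by_cases hl : l - i = 0
      · rw [sub_eq_zero] at hl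
        subst hl
        rw [em]; congr 2; ring
      · have h1 := hg i ⟨l - i, hl⟩
        have h2 := hg j ⟨l - i, hl⟩
        simp only [sub_add_cancel] at h1
        rw [h1, hm.2, ← h2]
        congr 2; ring

end PG

open Equiv
open scoped Pointwise

namespace PG

lemma card_perm_le {α : Type*} [Finite α] (G : Subgroup (Perm α)) :
    Nat.card G ≤ (Nat.card α).factorial := by
  have := Subgroup.card_le_card_group G
  rwa [Nat.card_perm] at this

lemma small_n {α : Type*} [Finite α] {p : ℕ} (G : Subgroup (Perm α))
    (hn : 2 ≤ Nat.card α) (hpn : Nat.card α < p) : Nat.card G < p ^ (Nat.card α - 1) := by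
  refine lt_of_le_of_lt (card_perm_le G) ?_
  obtain ⟨m, hm⟩ : ∃ m, Nat.card α = m + 2 := ⟨Nat.card α - 2, by omega⟩
  rw [hm] at hpn ⊢
  have h1 : (m + 2).factorial ≤ (m + 2) ^ (m + 1) := by
    calc (m + 2).factorial = (m + 2) * (m + 1).factorial := Nat.factorial_succ _
      _ ≤ (m + 2) * (m + 1) ^ m := by
        gcongr
        calc (m + 1).factorial = (m + 1) * m.factorial := Nat.factorial_succ _
          _ ≤ (m + 1) ^ m := by
            clear * -
            induction m with
            | zero => simp
            | succ k ih =>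
              rw [Nat.factorial_succ]
              calc (k + 1 + 1) * ((k + 1) * k.factorial) ≤ (k + 1 + 1) * (k + 1) ^ k := by gcongr
                _ ≤ (k + 1 + 1) * (k + 1 + 1) ^ k := by gcongr; omega
                _ = _ := by ring
      _ ≤ (m + 2) * (m + 2) ^ m := by gcongr; omega
      _ = _ := by ring
  refine lt_of_le_of_lt h1 ?_
  exact Nat.pow_lt_pow_left hpn (by omega)

lemma min4 {α : Type*} [Fintype α] [DecidableEq α] {p : ℕ} (hp : p.Prime) (G : Subgroup (Perm α))
    (hG : ¬ p ∣ Nat.card G) (hprim : MulAction.IsPreprimitive G α) (hpn : p ≤ Nat.card α)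
    (hbig : p ^ (Nat.card α - 1) ≤ Nat.card G) (g : Perm α) (hg : g ∈ G) (h1 : g ≠ 1) :
    (¬ g.IsThreeCycle) ∧ 4 ≤ g.support.card := by
  have h2 : 2 ≤ g.support.card := Perm.two_le_card_support_of_ne_one h1
  have hns : g.support.card ≠ 2 := by
    intro h
    rw [Perm.card_support_eq_two] at h
    have := Perm.subgroup_eq_top_of_isPreprimitive_of_isSwap_mem hprim g h hg
    apply hG
    rw [this, Nat.card_congr (Subgroup.topEquiv).toEquiv, Nat.card_perm]
    exact hp.dvd_factorial.2 hpn
  have hnt : ¬ g.IsThreeCycle := by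
    intro h
    have hle := Perm.alternatingGroup_le_of_isPreprimitive_of_isThreeCycle_mem hprim h hg
    have h3 : g.support.card = 3 := h.card_support
    have hn3 : 3 ≤ Nat.card α := by
      rw [Nat.card_eq_fintype_card, ← h3]; exact Finset.card_le_univ _
    have : Nontrivial α := by
      rw [← Finite.one_lt_card_iff_nontrivial]; omega
    have hA : 2 * Nat.card (alternatingGroup α) = (Nat.card α).factorial := by
      rw [← Nat.card_perm]; exact two_mul_nat_card_alternatingGroup
    have hd := Subgroup.card_dvd_of_le hle
    by_cases hp2 : p = 2
    · subst hp2
      by_cases hn4 : 4 ≤ Nat.card α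
      · have h24 : Nat.factorial 4 ∣ (Nat.card α).factorial := Nat.factorial_dvd_factorial hn4
        rw [← hA] at h24
        apply hG
        refine dvd_trans ?_ hd
        have : Nat.factorial 4 = 2 * 12 := by decide
        rw [this] at h24
        have := Nat.dvd_of_mul_dvd_mul_left (by norm_num) h24
        exact dvd_trans (by norm_num) this
      · have hn : Nat.card α = 3 := by omega
        have hd2 := Subgroup.card_subgroup_dvd_card G
        rw [Nat.card_perm] at hd2
        rw [hn] at hd2 hbig
        have hle6 := Nat.le_of_dvd (by decide) hd2
        have : Nat.factorial 3 = 6 := by decide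
        rw [this] at hd2 hle6
        norm_num at hbig
        interval_cases (Nat.card G) <;> omega
    · have : p ∣ 2 * Nat.card (alternatingGroup α) := by
        rw [hA]; exact hp.dvd_factorial.2 hpn
      rcases (hp.dvd_mul).1 this with h | h
      · exact hp2 ((Nat.prime_dvd_prime_iff_eq hp Nat.prime_two).1 h)
      · exact hG (h.trans hd)
  refine ⟨hnt, ?_⟩
  have : g.support.card ≠ 3 := fun h => hnt (card_support_eq_three_iff.1 h)
  omega

lemma prim_data {α : Type} [Fintype α] [DecidableEq α] {p : ℕ} (hp : p.Prime)
    (IH : ∀ (β : Type) [Finite β], Nat.card β < Nat.card α → Good p β)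
    (G : Subgroup (Perm α)) (hG : ¬ p ∣ Nat.card G)
    (hprim : MulAction.IsPreprimitive G α) (hpn : p ≤ Nat.card α)
    (hbig : p ^ (Nat.card α - 1) ≤ Nat.card G) :
    ∃ t, 1 ≤ t ∧ t < p ∧ MulAction.IsMultiplyPretransitive G α t ∧
      ¬ MulAction.IsMultiplyPretransitive G α (t + 1) ∧
      ∀ x : Fin t ↪ α,
        (t + 2 ≤ kk (ptw G x)) ∧ (t = p - 1 → t + p ≤ kk (ptw G x)) ∧ 
        (Nat.card G = (Nat.card α).descFactorial t ∨
          ∃ g ∈ G, g ≠ 1 ∧ p ^ (2 * kk (ptw G x) + g.support.card) < 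
            p ^ 4 * ((Nat.card α).descFactorial t) ^ 2) := by
  classical
  have hp2 := hp.two_le
  set t := Nat.findGreatest (fun t => MulAction.IsMultiplyPretransitive G α t) (p - 1) with ht
  have hone : MulAction.IsMultiplyPretransitive G α 1 :=
    MulAction.is_one_pretransitive_iff.2 hprim.toIsPretransitive
  have h1 : 1 ≤ t := Nat.le_findGreatest (by omega) hone
  have h2 : t ≤ p - 1 := Nat.findGreatest_le _
  have h3 : MulAction.IsMultiplyPretransitive G α t := 
    Nat.findGreatest_spec (P := fun t => MulAction.IsMultiplyPretransitive G α t)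
      (m := 1) (by omega) hone
  have h4 : ¬ MulAction.IsMultiplyPretransitive G α (t + 1) := by
    by_cases h : t = p - 1
    · rw [h, show p - 1 + 1 = p by omega]
      exact not_p_trans hp G hG hpn
    · exact Nat.findGreatest_is_greatest (P := fun t => MulAction.IsMultiplyPretransitive G α t)
        (n := p - 1) (by omega) (by omega)
  refine ⟨t, h1, by omega, h3, h4, fun x => ?_⟩
  have hk := kk_two G t h3 h4 x
  have hc := card_ptw_mul h3 x
  refine ⟨hk, ?_, ?_⟩
  · intro e
    clear_value t
    subst e
    exact kk_p hp G hG hpn h3 x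
  · by_cases hb : ptw G x = ⊥
    · left; rw [hc, hb]; simp
    · right
      obtain ⟨g, hg, hne, hlt⟩ := key_lemma hp IH G hG hprim t h1 h4 (ptw G x) ptw_le hb (by omega)
      refine ⟨g, hg, hne, ?_⟩
      set D := (Nat.card α).descFactorial t
      set k := kk (ptw G x)
      set m := g.support.card
      set c := Nat.card (ptw G x)
      set n := Nat.card α
      have hD : 0 < D := by
        rcases Nat.eq_zero_or_pos D with h | h
        · rw [h, mul_zero] at hc
          have : 0 < Nat.card G := Nat.card_pos
          omega
        · exact h
      have e1 : (p ^ (n - 1)) ^ 2 * p ^ (2 * k + m) < p ^ (2 * n + 2) * D ^ 2 := by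
        calc (p ^ (n - 1)) ^ 2 * p ^ (2 * k + m) ≤ (Nat.card G) ^ 2 * p ^ (2 * k + m) := by gcongr
          _ = ((c * p ^ k) ^ 2 * p ^ m) * D ^ 2 := by rw [hc]; ring
          _ < _ := by gcongr
      have e2 : p ^ (2 * n + 2) = (p ^ (n - 1)) ^ 2 * p ^ 4 := by
        rw [← pow_mul, ← pow_add]; congr 1; omega
      rw [e2, mul_assoc] at e1
      exact lt_of_mul_lt_mul_left' e1
    
end PG

open Equiv
open scoped Pointwise

namespace PG

lemma comm_supp {α : Type*} [Fintype α] [DecidableEq α] (g h : Perm α) :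
    (g * h * g⁻¹ * h⁻¹).support.card ≤ 3 * (g.support ∩ h.support).card := by
  set Z := g.support ∩ h.support with hZ
  have hsub : (g * h * g⁻¹ * h⁻¹).support ⊆ Z ∪ (Z.image g ∪ Z.image h) := by
    intro x
    contrapose!
    intro hx
    simp only [Finset.mem_union, Finset.mem_image, not_or, not_exists, not_and] at hx
    obtain ⟨h0, h1, h2⟩ := hx
    have h1' : g⁻¹ x ∉ Z := fun h => h1 _ h (by simp)
    have h2' : h⁻¹ x ∉ Z := fun h' => h2 _ h' (by simp)
    simp only [hZ, Finset.mem_inter, not_and_or, Perm.notMem_support] at h0 h1' h2'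
    rw [Perm.notMem_support]
    suffices hs : g⁻¹ (h⁻¹ x) = h⁻¹ (g⁻¹ x) by
      simp only [Perm.mul_apply]
      rw [hs]; simp
    have eqg : ∀ y, g y = y → g⁻¹ y = y := fun y hy => by rw [Perm.inv_eq_iff_eq]; exact hy.symm
    have eqh : ∀ y, h y = y → h⁻¹ y = y := fun y hy => by rw [Perm.inv_eq_iff_eq]; exact hy.symm
    by_cases hxh : h x = x
    · rw [eqh x hxh]
      by_cases hc : h (g⁻¹ x) = g⁻¹ x
      · exact (eqh _ hc).symm
      · have h3 : g (g⁻¹ x) = g⁻¹ x := by tauto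
        rw [← Perm.mul_apply, mul_inv_cancel, Perm.one_apply] at h3
        rw [← h3, eqh x hxh]
    · have hxg : g x = x := by tauto
      rw [eqg x hxg]
      apply eqg
      rcases h2' with h | h
      · exact h
      · rw [← Perm.mul_apply, mul_inv_cancel, Perm.one_apply] at h
        rw [← h]; exact hxg
  calc _ ≤ (Z ∪ (Z.image g ∪ Z.image h)).card := Finset.card_le_card hsub
    _ ≤ Z.card + ((Z.image g).card + (Z.image h).card) :=
      (Finset.card_union_le _ _).trans (Nat.add_le_add_left (Finset.card_union_le _ _) _)
    _ ≤ Z.card + (Z.card + Z.card) := 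
      Nat.add_le_add_left (Nat.add_le_add Finset.card_image_le Finset.card_image_le) _
    _ = _ := by ring

lemma comm_ne_one {α : Type*} (g h : Perm α) (a : α) (ha : h a ≠ a)
    (hga : h (g a) = g a) : g * h * g⁻¹ * h⁻¹ ≠ 1 := by
  intro e
  have : g * h = h * g := by
    have h1 := congrArg (fun k => k * h * g) e
    simpa [mul_assoc] using h1
  have h2 := congrArg (fun k : Perm α => k a) this
  simp only [Perm.mul_apply, hga] at h2
  exact ha (g.injective h2)

lemma bochert {α : Type*} [Fintype α] [DecidableEq α] (G : Subgroup (Perm α))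
    (h4 : ∀ g ∈ G, g ≠ 1 → 4 ≤ g.support.card) :
    ∃ B : Finset α, 2 * B.card ≤ Fintype.card α ∧
      ∀ g ∈ G, (∀ b ∈ B, g b = b) → g = 1 := by
  obtain ⟨B, hB, hmin⟩ := Set.exists_min_image
    {B : Finset α | ∀ g ∈ G, (∀ b ∈ B, g b = b) → g = 1} Finset.card (Set.toFinite _)
    ⟨Finset.univ, fun g _ h => Equiv.ext (fun x => h x (Finset.mem_univ x))⟩
  refine ⟨B, ?_, hB⟩
  by_contra hc
  push Not at hc
  have hcc := Finset.card_add_card_compl B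
  have hD : ¬ (∀ g ∈ G, (∀ b ∈ Bᶜ, g b = b) → g = 1) := fun h => by
    have := hmin _ h; omega
  push Not at hD
  obtain ⟨h, hhG, hh, hne⟩ := hD
  obtain ⟨b, hb⟩ : ∃ b, h b ≠ b := by
    by_contra hc; push Not at hc; exact hne (Equiv.ext hc)
  have hbB : b ∈ B := by
    by_contra hbB; exact hb (hh b (Finset.mem_compl.2 hbB))
  have hE : ¬ (∀ g ∈ G, (∀ b' ∈ B.erase b, g b' = b') → g = 1) := fun h => by
    have := hmin _ h
    have := Finset.card_erase_lt_of_mem hbB; omega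
  push Not at hE
  obtain ⟨g, hgG, hg, hgne⟩ := hE
  have hgb : g b ≠ b := by
    intro e
    apply hgne
    apply hB g hgG
    intro b' hb'
    by_cases h : b' = b
    · rw [h, e]
    · exact hg b' (Finset.mem_erase.2 ⟨h, hb'⟩)
  have hZ : g.support ∩ h.support ⊆ {b} := by
    intro x hx
    rw [Finset.mem_inter, Perm.mem_support, Perm.mem_support] at hx
    have hxB : x ∈ B := by
      by_contra hxB; exact hx.2 (hh x (Finset.mem_compl.2 hxB))
    rw [Finset.mem_singleton]
    by_contra hxb
    exact hx.1 (hg x (Finset.mem_erase.2 ⟨hxb, hxB⟩))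
  have h5 := comm_supp g h
  have h6 := Finset.card_le_card hZ
  rw [Finset.card_singleton] at h6
  have h7 : g * h * g⁻¹ * h⁻¹ ≠ 1 := by
    apply comm_ne_one g h b hb
    by_contra hc
    have : g b ∈ ({b} : Finset α) := hZ (by
      rw [Finset.mem_inter, Perm.mem_support, Perm.mem_support]
      exact ⟨fun e => hgb (g.injective e), hc⟩)
    rw [Finset.mem_singleton] at this
    exact hgb this
  have h8 := h4 _ (G.mul_mem (G.mul_mem (G.mul_mem hgG hhG) (G.inv_mem hgG)) (G.inv_mem hhG)) h7
  omega

lemma bochert_card {α : Type*} [Fintype α] [DecidableEq α] (G : Subgroup (Perm α))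
    (h4 : ∀ g ∈ G, g ≠ 1 → 4 ≤ g.support.card) :
    Nat.card G ≤ (Nat.card α).descFactorial (Nat.card α / 2) := by
  obtain ⟨B, hB, hbase⟩ := bochert G h4
  have h1 : Nat.card G ≤ Nat.card (B ↪ α) := by
    apply Nat.card_le_card_of_injective
      (fun g : G => (⟨fun b => (g : Perm α) b, fun a b e =>
        Subtype.ext ((g : Perm α).injective e)⟩ : B ↪ α))
    intro g k e
    have e' : ∀ b ∈ B, (g : Perm α) b = (k : Perm α) b := fun b hb =>
      congrArg (fun f : B ↪ α => f ⟨b, hb⟩) e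
    have := hbase ((k : Perm α)⁻¹ * g) (G.mul_mem (G.inv_mem k.2) g.2) (fun b hb => by
      rw [Perm.mul_apply, e' b hb]; simp)
    ext1
    exact (inv_mul_eq_one.1 this).symm
  rw [Nat.card_eq_fintype_card (α := B ↪ α), Fintype.card_embedding_eq, Fintype.card_coe] at h1
  rw [Nat.card_eq_fintype_card (α := α)]
  refine h1.trans ?_
  set n := Fintype.card α
  have : ∀ k, B.card ≤ k → k ≤ n / 2 → n.descFactorial B.card ≤ n.descFactorial k := by
    intro k hk
    induction k, hk using Nat.le_induction with
    | base => intro _; exact le_rfl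
    | succ k hk ih =>
      intro h
      rw [Nat.descFactorial_succ]
      refine (ih (by omega)).trans (Nat.le_mul_of_pos_left _ (by omega))
  exact this _ (by omega) le_rfl

lemma bern2 (x : ℝ) (hx : 0 ≤ x) (k : ℕ) :
    1 + k * x + k * (k - 1) / 2 * x ^ 2 ≤ (1 + x) ^ k := by
  induction k with
  | zero => simp
  | succ k ih =>
    rw [pow_succ]
    have h1 : (1 + k * x + k * (k - 1) / 2 * x ^ 2) * (1 + x) ≤ (1 + x) ^ k * (1 + x) := by
      gcongr
    refine le_trans ?_ h1
    push_cast
    have : 0 ≤ (k : ℝ) * (k - 1) / 2 * x ^ 3 := by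
      rcases Nat.eq_zero_or_pos k with h | h
      · subst h; simp
      · have : (1 : ℝ) ≤ k := by exact_mod_cast h
        have : 0 ≤ (k : ℝ) - 1 := by linarith
        positivity
    nlinarith

lemma desc_even (m : ℕ) (hm : 5 ≤ m) :
    ((2 * m).descFactorial m) ^ 2 < (2 * m) ^ (2 * m - 1) := by
  induction m, hm using Nat.le_induction with
  | base => decide
  | succ m hm ih =>
    have e : (2 * (m + 1)).descFactorial (m + 1) = 2 * (2 * m + 1) * (2 * m).descFactorial m := by
      have h1 := Nat.factorial_mul_descFactorial (n := 2 * m) (k := m) (by omega)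
      have h2 := Nat.factorial_mul_descFactorial (n := 2 * (m + 1)) (k := m + 1) (by omega)
      rw [show 2 * m - m = m by omega] at h1
      rw [show 2 * (m + 1) - (m + 1) = m + 1 by omega] at h2
      have h3 : (2 * (m + 1)).factorial = (2 * m + 2) * ((2 * m + 1) * (2 * m).factorial) := by
        rw [show 2 * (m + 1) = 2 * m + 1 + 1 by ring, Nat.factorial_succ, Nat.factorial_succ]
      rw [h3, ← h1, Nat.factorial_succ] at h2
      have h4 : 0 < (m + 1) * m.factorial := by positivity
      apply Nat.eq_of_mul_eq_mul_left h4
      rw [h2]; ring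
    rw [e, mul_pow]
    have key : (2 * (2 * m + 1)) ^ 2 * (2 * m) ^ (2 * m - 1) ≤ (2 * (m + 1)) ^ (2 * (m + 1) - 1) := by
      obtain ⟨k, hk⟩ : ∃ k, 2 * m - 1 = k := ⟨_, rfl⟩
      rw [show 2 * (m + 1) - 1 = (2 * m - 1) + 2 by omega, hk]
      have hm0 : (0 : ℝ) < m := by exact_mod_cast (by omega : 0 < m)
      have hkr : (k : ℝ) = 2 * m - 1 := by
        rw [eq_sub_iff_add_eq]; exact_mod_cast (by omega : k + 1 = 2 * m)
      have hb := bern2 (1 / m) (by positivity) k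
      have h4 : (4 : ℝ) ≤ (1 + 1 / m) ^ k := by
        refine le_trans ?_ hb
        rw [hkr]
        have hm5 : (5 : ℝ) ≤ m := by exact_mod_cast hm
        have : (1 : ℝ) + (2 * m - 1) * (1 / m) + (2 * m - 1) * (2 * m - 1 - 1) / 2 * (1 / m) ^ 2 
          = (5 * m ^ 2 - 4 * m + 1) / m ^ 2 := by
          field_simp; ring
        rw [this, le_div_iff₀ (by positivity)]
        nlinarith
      have h5 : ((2 * (2 * m + 1)) ^ 2 * (2 * m) ^ k : ℝ) ≤ (2 * (m + 1)) ^ (k + 2) := by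
        have e1 : (2 * (m + 1) : ℝ) = (2 * m) * (1 + 1 / m) := by field_simp
        calc ((2 * (2 * m + 1)) ^ 2 * (2 * m) ^ k : ℝ) ≤ (4 * (2 * (m + 1)) ^ 2) * (2 * m) ^ k := by
              gcongr; nlinarith
          _ = (2 * (m + 1)) ^ 2 * ((2 * m) ^ k * 4) := by ring
          _ ≤ (2 * (m + 1)) ^ 2 * ((2 * m) ^ k * (1 + 1 / m) ^ k) := by gcongr
          _ = (2 * (m + 1)) ^ 2 * (2 * (m + 1)) ^ k := by rw [← mul_pow, ← e1]
          _ = _ := by ring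
      exact_mod_cast h5
    calc _ < (2 * (2 * m + 1)) ^ 2 * (2 * m) ^ (2 * m - 1) := by gcongr
      _ ≤ _ := key

lemma boch_num (n p : ℕ) (hp : 3 ≤ p) (hn : 2 ≤ n) (hnp : n ≤ p ^ 2) :
    n.descFactorial (n / 2) < p ^ (n - 1) := by
  rcases Nat.even_or_odd' n with ⟨m, h | h⟩
  · subst h
    rw [show 2 * m / 2 = m by omega]
    by_cases hm : 5 ≤ m
    · have h1 := desc_even m hm
      have h2 : (2 * m) ^ (2 * m - 1) ≤ (p ^ (2 * m - 1)) ^ 2 := by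
        rw [← pow_mul, mul_comm (2 * m - 1) 2, pow_mul]; gcongr
      exact lt_of_pow_lt_pow_left₀ 2 (Nat.zero_le _) (h1.trans_le h2)
    · refine lt_of_lt_of_le ?_ (Nat.pow_le_pow_left hp _)
      have : 1 ≤ m := by omega
      have : m ≤ 4 := by omega
      interval_cases m <;> decide
  · subst h
    rw [show (2 * m + 1) / 2 = m by omega, show 2 * m + 1 - 1 = 2 * m by omega]
    have h1 : (2 * m + 1) ^ m ≤ p ^ (2 * m) := by rw [pow_mul]; gcongr
    by_cases hm : 2 ≤ m
    · exact (Nat.descFactorial_lt_pow (by omega) hm).trans_le h1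
    · have : m = 1 := by omega
      subst this
      simp
      nlinarith

end PG

open Equiv
open scoped Pointwise

namespace PG

abbrev stb {α : Type*} (G : Subgroup (Perm α)) (v : α) : Subgroup (Perm α) :=
  ptw G (fun _ : Fin 1 => v)

lemma mem_stb {α : Type*} {G : Subgroup (Perm α)} {v : α} {g : Perm α} :
    g ∈ stb G v ↔ g ∈ G ∧ g v = v := by
  simp [mem_ptw]

section count
open Classical
variable {α : Type*} [Fintype α]

lemma count_off (v : α) (f : α → ℕ) (C : ℕ) (hv : f v = 0) (h : ∀ w, f w ≤ C) :
    ∑ w, f w ≤ (Fintype.card α - 1) * C := by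
  rw [← Finset.add_sum_erase _ _ (Finset.mem_univ v), hv, zero_add]
  refine (Finset.sum_le_card_nsmul _ _ C (fun w _ => h w)).trans ?_
  rw [Finset.card_erase_of_mem (Finset.mem_univ v), Finset.card_univ, smul_eq_mul]

lemma sumE (G : Subgroup (Perm α)) (v : α) (C : ℕ)
    (hC : ∀ w, ∃ f ∈ G, f v = w ∧ f.support.card ≤ C) :
    ∑ z, (Finset.univ.filter (fun w => ¬ (orb (stb G z)) v w)).card ≤ (Fintype.card α - 1) * C := by
  have e : ∑ z, (Finset.univ.filter (fun w => ¬ (orb (stb G z)) v w)).card =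
      ∑ w, (Finset.univ.filter (fun z => ¬ (orb (stb G z)) v w)).card := by
    simp only [Finset.card_filter]
    exact Finset.sum_comm
  rw [e]
  apply count_off v
  · rw [Finset.card_eq_zero, Finset.filter_eq_empty_iff]
    intro z _ h
    exact h ((orb _).refl v)
  · intro w
    obtain ⟨f, hf, hw, hs⟩ := hC w
    refine le_trans (Finset.card_le_card ?_) hs
    intro z hz
    rw [Perm.mem_support]
    intro hfz
    exact (Finset.mem_filter.1 hz).2 ⟨f, mem_stb.2 ⟨hf, hfz⟩, hw⟩

lemma half (G : Subgroup (Perm α)) (v : α) (C : ℕ)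
    (hC : ∀ w, ∃ f ∈ G, f v = w ∧ f.support.card ≤ C)
    (hh : ∀ z, 2 * (Finset.univ.filter (fun w => (orb (stb G z)) v w)).card ≤ Fintype.card α) :
    Fintype.card α < 2 * C := by
  have h1 := sumE G v C hC
  have hpos : 0 < Fintype.card α := Fintype.card_pos_iff.2 ⟨v⟩
  have h2 : ∑ z : α, Fintype.card α ≤
      ∑ z, 2 * (Finset.univ.filter (fun w => ¬ (orb (stb G z)) v w)).card := by
    apply Finset.sum_le_sum
    intro z _
    have := Finset.card_filter_add_card_filter_not (s := Finset.univ)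
      (fun w => (orb (stb G z)) v w)
    rw [Finset.card_univ] at this
    have := hh z
    omega
  rw [← Finset.mul_sum, Finset.sum_const, Finset.card_univ, smul_eq_mul] at h2
  obtain ⟨m, hm⟩ : ∃ m, Fintype.card α = m + 1 := ⟨_, (Nat.succ_pred_eq_of_pos hpos).symm⟩
  rw [hm] at h1 h2 ⊢
  simp only [Nat.add_sub_cancel] at h1
  by_contra hc
  push Not at hc
  nlinarith

lemma outdeg (G : Subgroup (Perm α)) (ht : MulAction.IsPretransitive G α) (R : α → α → Prop)
    (hR : ∀ g ∈ G, ∀ x y, R x y → R (g x) (g y)) (v w : α) :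
    (Finset.univ.filter (fun z => R v z)).card = (Finset.univ.filter (fun z => R w z)).card := by
  obtain ⟨g, hg⟩ := ht.exists_smul_eq v w
  apply Finset.card_bij (fun z _ => (g : Perm α) z)
  · intro z hz
    rw [Finset.mem_filter] at hz ⊢
    refine ⟨Finset.mem_univ _, ?_⟩
    rw [← hg]; exact hR g g.2 _ _ hz.2
  · intro a _ b _ h; exact (g : Perm α).injective h
  · intro z hz
    rw [Finset.mem_filter] at hz
    refine ⟨(g : Perm α)⁻¹ z, ?_, by simp⟩
    rw [Finset.mem_filter]
    refine ⟨Finset.mem_univ _, ?_⟩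
    have := hR (g : Perm α)⁻¹ (G.inv_mem g.2) _ _ hz.2
    have e : (g : Perm α)⁻¹ w = v := by rw [Perm.inv_eq_iff_eq]; exact hg.symm
    rwa [e] at this

lemma indeg (G : Subgroup (Perm α)) (ht : MulAction.IsPretransitive G α) (R : α → α → Prop)
    (hR : ∀ g ∈ G, ∀ x y, R x y → R (g x) (g y)) (v : α) :
    (Finset.univ.filter (fun z => R z v)).card = (Finset.univ.filter (fun z => R v z)).card := by
  have e : ∑ v, (Finset.univ.filter (fun z => R z v)).card =
      ∑ z, (Finset.univ.filter (fun v => R z v)).card := by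
    simp only [Finset.card_filter]
    exact Finset.sum_comm
  rw [Finset.sum_congr rfl (fun w _ => outdeg G ht (fun x y => R y x)
    (fun g hg x y h => hR g hg y x h) w v),
    Finset.sum_congr rfl (fun w _ => outdeg G ht R hR w v)] at e
  simp only [Finset.sum_const, Finset.card_univ, smul_eq_mul] at e
  exact Nat.eq_of_mul_eq_mul_left (Fintype.card_pos_iff.2 ⟨v⟩) e

lemma relE (G : Subgroup (Perm α)) (ht : MulAction.IsPretransitive G α) (R : α → α → Prop)
    (hR : ∀ g ∈ G, ∀ x y, R x y → R (g x) (g y)) (v : α) (C d : ℕ)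
    (hd : (Finset.univ.filter (fun z => R v z)).card = d)
    (hC : ∀ w, ∃ f ∈ G, f v = w ∧ f.support.card ≤ C) :
    2 * (d * (Fintype.card α - d)) ≤ (Fintype.card α - 1) * C := by
  have hR' : ∀ g ∈ G, ∀ x y, R (g x) (g y) ↔ R x y := by
    intro g hg x y
    refine ⟨fun h => ?_, hR g hg x y⟩
    have := hR g⁻¹ (G.inv_mem hg) _ _ h
    simpa using this
  have e : ∑ z, (Finset.univ.filter (fun w => ¬ (R v z ↔ R w z))).card =
      ∑ w, (Finset.univ.filter (fun z => ¬ (R v z ↔ R w z))).card := by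
    simp only [Finset.card_filter]
    exact Finset.sum_comm
  have h1 : ∑ w, (Finset.univ.filter (fun z => ¬ (R v z ↔ R w z))).card ≤ 
      (Fintype.card α - 1) * C := by
    apply count_off v
    · simp
    · intro w
      obtain ⟨f, hf, hw, hs⟩ := hC w
      refine le_trans (Finset.card_le_card ?_) hs
      intro z hz
      rw [Perm.mem_support]
      intro hfz
      apply (Finset.mem_filter.1 hz).2
      rw [← hw, ← hR' f hf v z, hfz]
  rw [← e] at h1
  refine le_trans (le_of_eq ?_) h1
  have hin : ∀ z, (Finset.univ.filter (fun w => R w z)).card = d := fun z => by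
    rw [indeg G ht R hR z, outdeg G ht R hR z v, hd]
  have hnin : ∀ z, (Finset.univ.filter (fun w => ¬ R w z)).card = Fintype.card α - d := fun z => by
    have := Finset.card_filter_add_card_filter_not (s := Finset.univ) (fun w => R w z)
    rw [hin, Finset.card_univ] at this
    omega
  have hz : ∀ z, (Finset.univ.filter (fun w => ¬ (R v z ↔ R w z))).card = 
      if R v z then Fintype.card α - d else d := by
    intro z
    split_ifs with h
    · simp only [h, true_iff]; exact hnin z
    · simp only [h, false_iff, not_not]; exact hin z
  rw [Finset.sum_congr rfl (fun z _ => hz z), Finset.sum_ite, Finset.sum_const, Finset.sum_const, hd]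
  have : (Finset.univ.filter (fun z => ¬ R v z)).card = Fintype.card α - d := by
    have := Finset.card_filter_add_card_filter_not (s := Finset.univ) (fun w => R v w)
    rw [hd, Finset.card_univ] at this
    omega
  rw [this]
  simp only [smul_eq_mul]
  ring

end count

lemma no_swap {α : Type*} [Finite α] (G : Subgroup (Perm α)) (hG : ¬ 2 ∣ Nat.card G)
    (g : Perm α) (hg : g ∈ G) (v w : α) (h1 : g v = w) (h2 : g w = v) : v = w := by
  have h3 : ∀ k : ℕ, (g ^ (2 * k + 1)) v = w := by
    intro k
    induction k with
    | zero => simpa using h1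
    | succ k ih =>
      rw [show 2 * (k + 1) + 1 = (2 * k + 1) + 2 by ring, pow_add, Perm.mul_apply]
      rw [show (g ^ 2) v = v by rw [sq, Perm.mul_apply, h1, h2], ih]
  have h4 : g ^ Nat.card G = 1 := by
    have := pow_card_eq_one' (x := (⟨g, hg⟩ : G))
    exact congrArg Subtype.val this
  have h5 := h3 (Nat.card G / 2)
  rw [show 2 * (Nat.card G / 2) + 1 = Nat.card G by omega, h4] at h5
  exact h5

section diam
variable {α : Type*} [Fintype α] [DecidableEq α]

def Bl (G : Subgroup (Perm α)) (m : ℕ) (v : α) (i : ℕ) : Set α :=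
  {w | ∃ f ∈ G, f.support.card ≤ i * m ∧ f v = w}

lemma Bl_mono (G : Subgroup (Perm α)) (m : ℕ) (v : α) (i : ℕ) : Bl G m v i ⊆ Bl G m v (i + 1) := by
  rintro w ⟨f, hf, hs, e⟩
  exact ⟨f, hf, hs.trans (Nat.mul_le_mul_right _ (by omega)), e⟩

lemma Bl_self (G : Subgroup (Perm α)) (m : ℕ) (v : α) (i : ℕ) : v ∈ Bl G m v i :=
  ⟨1, G.one_mem, by simp, rfl⟩

lemma Bl_inv (G : Subgroup (Perm α)) (m : ℕ) (v : α) (i : ℕ) (a b : α)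
    (h : (orb (stb G v)) a b) (ha : a ∈ Bl G m v i) : b ∈ Bl G m v i := by
  obtain ⟨h, hh, rfl⟩ := h
  obtain ⟨f, hf, hs, rfl⟩ := ha
  rw [mem_stb] at hh
  refine ⟨h * f * h⁻¹, G.mul_mem (G.mul_mem hh.1 hf) (G.inv_mem hh.1), ?_, ?_⟩
  · rwa [Perm.card_support_conj]
  · simp only [Perm.mul_apply]
    rw [show h⁻¹ v = v by rw [Perm.inv_eq_iff_eq]; exact hh.2.symm]

lemma Bl_full (G : Subgroup (Perm α)) (hprim : MulAction.IsPreprimitive G α) (m : ℕ) (v : α) (i : ℕ)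
    (g0 : Perm α) (hg0 : g0 ∈ G) (h1 : g0 ≠ 1) (hm : g0.support.card ≤ m)
    (h : Bl G m v (i + 1) ⊆ Bl G m v i) : Bl G m v i = Set.univ := by
  let T : Set (Perm α) := {f | f ∈ G ∧ f.support.card ≤ m}
  let C := Subgroup.closure T
  obtain ⟨x, hx⟩ : ∃ x, g0 x ≠ x := by
    by_contra hc; push Not at hc; exact h1 (Equiv.ext hc)
  have hconj : ∀ g ∈ G, ∀ c ∈ C, g * c * g⁻¹ ∈ C := by
    intro g hg c hc
    have : C ≤ C.comap (MulAut.conj g).toMonoidHom := by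
      rw [Subgroup.closure_le]
      rintro f ⟨hf, hs⟩
      apply Subgroup.subset_closure
      refine ⟨G.mul_mem (G.mul_mem hg hf) (G.inv_mem hg), ?_⟩
      simp only [MulEquiv.toMonoidHom_eq_coe, MonoidHom.coe_coe, MulAut.conj_apply]
      rwa [Perm.card_support_conj]
    exact this hc
  have htot := prim_setoid hprim (orb C) (by
    rintro ⟨g, hg⟩ a b ⟨c, hc, rfl⟩
    refine ⟨g * c * g⁻¹, hconj g hg c hc, ?_⟩
    change (g * c * g⁻¹) (g a) = g (c a)
    simp) x (g0 x) hx.symm ⟨g0, Subgroup.subset_closure ⟨hg0, hm⟩, rfl⟩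
  have hstab : ∀ c ∈ C, ∀ w, w ∈ Bl G m v i → c w ∈ Bl G m v i := by
    intro c hc
    induction hc using Subgroup.closure_induction'' with
    | one => intro w hw; exact hw
    | mem f hf =>
      rintro w ⟨f', hf', hs', rfl⟩
      apply h
      refine ⟨f * f', G.mul_mem hf.1 hf', ?_, rfl⟩
      refine (Finset.card_le_card (Perm.support_mul_le f f')).trans ?_
      refine (Finset.card_union_le _ _).trans ?_
      have := hf.2
      rw [add_mul]; omega
    | inv_mem f hf =>
      rintro w ⟨f', hf', hs', rfl⟩
      apply h
      refine ⟨f⁻¹ * f', G.mul_mem (G.inv_mem hf.1) hf', ?_, rfl⟩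
      refine (Finset.card_le_card (Perm.support_mul_le _ f')).trans ?_
      refine (Finset.card_union_le _ _).trans ?_
      rw [Perm.support_inv]
      have := hf.2
      rw [add_mul]; omega
    | mul a b _ _ ha hb => intro w hw; exact ha _ (hb _ hw)
  rw [Set.eq_univ_iff_forall]
  intro w
  obtain ⟨c, hc, rfl⟩ := htot v w
  exact hstab c hc v (Bl_self G m v i)

/-- number of orbits in the ball -/
noncomputable def cB (G : Subgroup (Perm α)) (m : ℕ) (v : α) (i : ℕ) : ℕ :=
  ((fun x => Quotient.mk (orb (stb G v)) x) '' Bl G m v i).ncard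

lemma cB_zero (G : Subgroup (Perm α)) (m : ℕ) (v : α) : 1 ≤ cB G m v 0 := by
  unfold cB
  rw [Nat.succ_le_iff, Set.ncard_pos (Set.toFinite _)]
  exact ⟨_, v, Bl_self G m v 0, rfl⟩

lemma cB_le (G : Subgroup (Perm α)) (m : ℕ) (v : α) (i : ℕ) : cB G m v i ≤ kk (stb G v) := by
  unfold cB kk
  exact (Set.ncard_le_card _).trans le_rfl

lemma cB_full (G : Subgroup (Perm α)) (m : ℕ) (v : α) (i : ℕ) (h : kk (stb G v) ≤ cB G m v i) :
    Bl G m v i = Set.univ := by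
  have : ((fun x => Quotient.mk (orb (stb G v)) x) '' Bl G m v i) = Set.univ := by
    apply Set.eq_of_subset_of_ncard_le (Set.subset_univ _) _ (Set.toFinite _)
    rw [Set.ncard_univ]; exact h
  rw [Set.eq_univ_iff_forall] at this ⊢
  intro w
  obtain ⟨a, ha, e⟩ := this (Quotient.mk _ w)
  exact Bl_inv G m v i a w (Quotient.exact e) ha

lemma cB_step (G : Subgroup (Perm α)) (m : ℕ) (v : α) (i : ℕ)
    (h : ¬ Bl G m v (i + 1) ⊆ Bl G m v i) : cB G m v i + 1 ≤ cB G m v (i + 1) := by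
  rw [Set.not_subset] at h
  obtain ⟨w, hw, hwn⟩ := h
  unfold cB
  apply Set.ncard_lt_ncard _ (Set.toFinite _)
  rw [Set.ssubset_iff_of_subset (Set.image_mono (Bl_mono G m v i))]
  refine ⟨_, ⟨w, hw, rfl⟩, ?_⟩
  rintro ⟨a, ha, e⟩
  exact hwn (Bl_inv G m v i a w (Quotient.exact e) ha)

lemma cB_step2 (G : Subgroup (Perm α)) (hG : ¬ 2 ∣ Nat.card G) (m : ℕ) (v : α) (i : ℕ)
    (h : ¬ Bl G m v (i + 1) ⊆ Bl G m v i) : cB G m v i + 2 ≤ cB G m v (i + 1) := by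
  rw [Set.not_subset] at h
  obtain ⟨w, hw, hwn⟩ := h
  obtain ⟨f, hf, hs, rfl⟩ := hw
  have hw2 : f⁻¹ v ∈ Bl G m v (i + 1) := ⟨f⁻¹, G.inv_mem hf, by rwa [Perm.support_inv], rfl⟩
  have hw2n : f⁻¹ v ∉ Bl G m v i := by
    rintro ⟨f', hf', hs', e⟩
    apply hwn
    have h1 : f * f' ∈ stb G v := mem_stb.2 ⟨G.mul_mem hf hf', by
      rw [Perm.mul_apply, e]; simp⟩
    apply Bl_inv G m v i (f'⁻¹ v) (f v) ⟨f * f', h1, by simp⟩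
    exact ⟨f'⁻¹, G.inv_mem hf', by rwa [Perm.support_inv], rfl⟩
  have hne : ¬ (orb (stb G v)) (f v) (f⁻¹ v) := by
    rintro ⟨k, hk, e⟩
    rw [mem_stb] at hk
    have := no_swap G hG (f * k) (G.mul_mem hf hk.1) v (f v) (by simp [hk.2]) (by
      rw [Perm.mul_apply, e]; simp)
    rw [← this] at hwn
    exact hwn (Bl_self G m v i)
  unfold cB
  set q := fun x => Quotient.mk (orb (stb G v)) x
  have hnot : ∀ w, w ∉ Bl G m v i → q w ∉ q '' Bl G m v i := by
    rintro w hw ⟨a, ha, e⟩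
    exact hw (Bl_inv G m v i a w (Quotient.exact e) ha)
  have hsub : insert (q (f v)) (insert (q (f⁻¹ v)) (q '' Bl G m v i)) ⊆ q '' Bl G m v (i + 1) := by
    rintro z (rfl | rfl | hz)
    · exact ⟨_, ⟨f, hf, hs, rfl⟩, rfl⟩
    · exact ⟨_, hw2, rfl⟩
    · exact Set.image_mono (Bl_mono G m v i) hz
  have := Set.ncard_le_ncard hsub (Set.toFinite _)
  rw [Set.ncard_insert_of_notMem _ (Set.toFinite _), 
    Set.ncard_insert_of_notMem (hnot _ hw2n) (Set.toFinite _)] at this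
  · exact this
  · rintro (h | h)
    · exact hne (Quotient.exact h)
    · exact hnot _ hwn h

lemma diam (G : Subgroup (Perm α)) (hprim : MulAction.IsPreprimitive G α) (m : ℕ) (v : α)
    (g0 : Perm α) (hg0 : g0 ∈ G) (h1 : g0 ≠ 1) (hm : g0.support.card ≤ m) (s : ℕ)
    (hstep : ∀ i, ¬ Bl G m v (i + 1) ⊆ Bl G m v i → cB G m v i + s ≤ cB G m v (i + 1))
    (L : ℕ) (hL : kk (stb G v) ≤ 1 + L * s) :
    ∀ w, ∃ f ∈ G, f v = w ∧ f.support.card ≤ L * m := by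
  have key : ∀ i, Bl G m v i = Set.univ ∨ 1 + i * s ≤ cB G m v i := by
    intro i
    induction i with
    | zero => right; simpa using cB_zero G m v
    | succ i ih =>
      rcases ih with h | h
      · left
        rw [Set.eq_univ_iff_forall] at h ⊢
        exact fun w => Bl_mono G m v i (h w)
      · by_cases hs : Bl G m v (i + 1) ⊆ Bl G m v i
        · left
          have := Bl_full G hprim m v i g0 hg0 h1 hm hs
          rw [Set.eq_univ_iff_forall] at this ⊢
          exact fun w => Bl_mono G m v i (this w)
        · right
          have := hstep i hs
          rw [add_mul]; omega
  have hfull : Bl G m v L = Set.univ := by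
    rcases key L with h | h
    · exact h
    · exact cB_full G m v L (hL.trans h)
  intro w
  rw [Set.eq_univ_iff_forall] at hfull
  obtain ⟨f, hf, hs, e⟩ := hfull w
  exact ⟨f, hf, e, hs⟩

end diam

end PG

open Equiv
open scoped Pointwise

namespace PG

lemma two_pow_sq (m : ℕ) (h : 4 ≤ m) : m ^ 2 ≤ 2 ^ m := by
  induction m, h using Nat.le_induction with
  | base => norm_num
  | succ m hm ih => rw [pow_succ 2 m]; nlinarith

lemma two_pow_four (k : ℕ) (h : 4 ≤ k) : 4 * k ≤ 2 ^ k := by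
  induction k, h using Nat.le_induction with
  | base => norm_num
  | succ m hm ih => rw [pow_succ]; omega

lemma pow3_4 (m : ℕ) (h : 4 ≤ m) : 81 * m ^ 4 ≤ 256 * 3 ^ m := by
  induction m, h using Nat.le_induction with
  | base => norm_num
  | succ m hm ih =>
    rw [pow_succ 3]
    have : (m + 1) ^ 4 ≤ 3 * m ^ 4 := by
      obtain ⟨a, rfl⟩ := Nat.exists_eq_add_of_le hm
      ring_nf
      nlinarith [sq_nonneg a, pow_pos (Nat.zero_lt_succ a) 3]
    omega

lemma pow9_4 (m : ℕ) (h : 2 ≤ m) : 81 * m ^ 4 ≤ 16 * 9 ^ m := by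
  induction m, h using Nat.le_induction with
  | base => norm_num
  | succ m hm ih =>
    rw [pow_succ 9]
    have : (m + 1) ^ 4 ≤ 9 * m ^ 4 := by
      obtain ⟨a, rfl⟩ := Nat.exists_eq_add_of_le hm
      ring_nf
      nlinarith [sq_nonneg a, pow_pos (Nat.zero_lt_succ a) 3]
    omega

lemma num3 (n m y : ℕ) (hm : 4 ≤ m) (hy : 2 ≤ y) (h : 32 * n ≤ 13 * (y * m) ^ 2) :
    9 * n ^ 2 ≤ 3 ^ (m + 2 * y) := by
  have h1 := pow3_4 m hm
  have h2 := pow9_4 y hy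
  have h3 : 81 * m ^ 4 * (81 * y ^ 4) ≤ (256 * 3 ^ m) * (16 * 9 ^ y) := Nat.mul_le_mul h1 h2
  have h4 : (32 * n) ^ 2 ≤ (13 * (y * m) ^ 2) ^ 2 := Nat.pow_le_pow_left h 2
  rw [pow_add, pow_mul]
  norm_num
  have e1 : (32 * n) ^ 2 = 1024 * n ^ 2 := by ring
  have e2 : (13 * (y * m) ^ 2) ^ 2 = 169 * (m ^ 4 * y ^ 4) := by ring
  have e3 : 81 * m ^ 4 * (81 * y ^ 4) = 6561 * (m ^ 4 * y ^ 4) := by ring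
  have e4 : (256 * 3 ^ m) * (16 * 9 ^ y) = 4096 * (3 ^ m * 9 ^ y) := by ring
  rw [e1, e2] at h4
  rw [e3, e4] at h3
  omega

lemma num_srg (C n1 e : ℕ) (hC8 : 8 ≤ C) (h1 : n1 ≤ (e + 1) * e)
    (hE : 2 * ((e + 1) * (n1 + 1)) ≤ (n1 + e + 1) * C) (hz : e + 2 < n1) :
    32 * (1 + n1 + (e + 1)) ≤ 13 * C ^ 2 := by
  by_contra hcon
  push Not at hcon
  have hcon2 : C ^ 2 + 4 * C + 8 < 4 * (1 + n1 + (e + 1)) := by nlinarith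
  have h2d : C + 3 ≤ 2 * (e + 1) := by
    by_contra hc
    push Not at hc
    nlinarith
  zify at *
  have h3 : 0 ≤ (2 * (e + 1) - (C + 3) : ℤ) * (2 * (n1 + 1) - (C + 3)) := by
    apply mul_nonneg <;> linarith
  nlinarith

section
open Classical
variable {α : Type*} [Fintype α]

lemma uni2 (G : Subgroup (Perm α)) (hG : ¬ 2 ∣ Nat.card G)
    (hprim : MulAction.IsPreprimitive G α) (m : ℕ) (hm : 4 ≤ m) (v : α)
    (g0 : Perm α) (hg0 : g0 ∈ G) (h1 : g0 ≠ 1) (hm0 : g0.support.card ≤ m)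
    (hn : 2 ≤ Fintype.card α)
    (hk : 3 ≤ kk (stb G v))
    (hlt : 2 ^ (2 * kk (stb G v) + m) < 2 ^ 4 * (Fintype.card α) ^ 2) : False := by
  set k := kk (stb G v) with hkdef
  have ht : MulAction.IsPretransitive G α := hprim.toIsPretransitive
  have hC := diam G hprim m v g0 hg0 h1 hm0 2 (fun i => cB_step2 G hG m v i) (k / 2) (by omega)
  have hn2 := half G v _ hC (by
    intro z
    by_cases hzv : z = v
    · subst hzv
      have : (Finset.univ.filter (fun w => (orb (stb G z)) z w)).card ≤ 1 := by
        rw [Finset.card_le_one]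
        intro a ha b hb
        obtain ⟨g, hg, e⟩ := (Finset.mem_filter.1 ha).2
        obtain ⟨g', hg', e'⟩ := (Finset.mem_filter.1 hb).2
        rw [← e, ← e', (mem_stb.1 hg).2, (mem_stb.1 hg').2]
      omega
    · let R : α → α → Prop := fun x y => ∃ g ∈ G, g z = x ∧ g v = y
      have hR : ∀ g ∈ G, ∀ x y, R x y → R (g x) (g y) := by
        rintro g hg x y ⟨f, hf, rfl, rfl⟩
        exact ⟨g * f, G.mul_mem hg hf, rfl, rfl⟩
      have e1 : (Finset.univ.filter (fun w => (orb (stb G z)) v w)) =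
          (Finset.univ.filter (fun w => R z w)) := by
        apply Finset.filter_congr
        intro w _
        constructor
        · rintro ⟨g, hg, e⟩
          exact ⟨g, (mem_stb.1 hg).1, (mem_stb.1 hg).2, e⟩
        · rintro ⟨g, hg, e, e'⟩
          exact ⟨g, mem_stb.2 ⟨hg, e⟩, e'⟩
      have e2 : (Finset.univ.filter (fun w => R w z)).card = 
          (Finset.univ.filter (fun w => R z w)).card := by
        convert indeg G ht R hR z
      have hdis : Disjoint (Finset.univ.filter (fun w => R z w)) 
          (Finset.univ.filter (fun w => R w z)) := by
        rw [Finset.disjoint_filter]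
        rintro w _ ⟨g, hg, gz, gv⟩ ⟨h, hh, hz, hv⟩
        have hgi : g⁻¹ z = z := by rw [Perm.inv_eq_iff_eq]; exact gz.symm
        have hgw : g⁻¹ w = v := by rw [Perm.inv_eq_iff_eq]; exact gv.symm
        have := no_swap G hG (h * g⁻¹) (G.mul_mem hh (G.inv_mem hg)) z w
          (by rw [Perm.mul_apply, hgi, hz]) (by rw [Perm.mul_apply, hgw, hv])
        apply hzv
        apply g.injective
        rw [gz, gv, this]
      have := Finset.card_union_of_disjoint hdis
      have h3 := Finset.card_le_univ ((Finset.univ.filter (fun w => R z w)) ∪ 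
          (Finset.univ.filter (fun w => R w z)))
      rw [e1]
      omega)
  set n := Fintype.card α
  have hm2 := two_pow_sq m hm
  rw [pow_add, pow_mul] at hlt
  rcases Nat.lt_or_ge k 4 with h | h
  · have : k = 3 := by omega
    rw [this] at hlt hn2
    norm_num at hlt hn2
    nlinarith
  · have h5 := two_pow_four k h
    have h6 : n < k * m := by
      refine lt_of_lt_of_le hn2 ?_
      rw [← mul_assoc]
      exact Nat.mul_le_mul_right _ (by omega)
    have h7 : (4 * k) ^ 2 * m ^ 2 ≤ (2 ^ 2) ^ k * 2 ^ m := by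
      apply Nat.mul_le_mul _ hm2
      rw [← pow_mul, mul_comm 2 k, pow_mul]
      exact Nat.pow_le_pow_left h5 2
    have h8 : n ^ 2 ≤ (k * m) ^ 2 := Nat.pow_le_pow_left h6.le 2
    have : (4 * k) ^ 2 * m ^ 2 = 2 ^ 4 * (k * m) ^ 2 := by ring
    omega

lemma uni3_bound (G : Subgroup (Perm α)) 
    (hprim : MulAction.IsPreprimitive G α) (h2t : ¬ MulAction.IsMultiplyPretransitive G α 2)
    (v : α) (C : ℕ) (hC8 : 8 ≤ C)
    (hn : 2 ≤ Fintype.card α)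
    (hC : ∀ w, ∃ f ∈ G, f v = w ∧ f.support.card ≤ C) :
    32 * Fintype.card α ≤ 13 * C ^ 2 := by
  have ht : MulAction.IsPretransitive G α := hprim.toIsPretransitive
  by_cases hh : ∀ z, 2 * (Finset.univ.filter (fun w => (orb (stb G z)) v w)).card ≤ Fintype.card α
  · have := half G v C hC hh
    nlinarith
  push Not at hh
  obtain ⟨z, hz⟩ := hh
  have hzv : z ≠ v := by
    rintro rfl
    have : (Finset.univ.filter (fun w => (orb (stb G z)) z w)).card ≤ 1 := by
      rw [Finset.card_le_one]
      intro a ha b hb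
      obtain ⟨g, hg, e⟩ := (Finset.mem_filter.1 ha).2
      obtain ⟨g', hg', e'⟩ := (Finset.mem_filter.1 hb).2
      rw [← e, ← e', (mem_stb.1 hg).2, (mem_stb.1 hg').2]
    omega
  let R : α → α → Prop := fun x y => ∃ g ∈ G, g z = x ∧ g v = y
  have hR : ∀ g ∈ G, ∀ x y, R x y → R (g x) (g y) := by
    rintro g hg x y ⟨f, hf, rfl, rfl⟩
    exact ⟨g * f, G.mul_mem hg hf, rfl, rfl⟩
  have hR' : ∀ g ∈ G, ∀ x y, R (g x) (g y) → R x y := by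
    intro g hg x y h
    have := hR g⁻¹ (G.inv_mem hg) _ _ h
    simpa using this
  have e1 : (Finset.univ.filter (fun w => (orb (stb G z)) v w)) =
      (Finset.univ.filter (fun w => R z w)) := by
    apply Finset.filter_congr
    intro w _
    constructor
    · rintro ⟨g, hg, e⟩
      exact ⟨g, (mem_stb.1 hg).1, (mem_stb.1 hg).2, e⟩
    · rintro ⟨g, hg, e, e'⟩
      exact ⟨g, mem_stb.2 ⟨hg, e⟩, e'⟩
  rw [e1] at hz
  have e2 : (Finset.univ.filter (fun w => R w z)).card = 
      (Finset.univ.filter (fun w => R z w)).card := by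
    convert indeg G ht R hR z
  have hRirr : ∀ x, ¬ R x x := by
    rintro x ⟨g, hg, e, e'⟩
    exact hzv (g.injective (e.trans e'.symm))
  have hRsymm : ∀ x y, R x y → R y x := by
    have hnd : ¬ Disjoint (Finset.univ.filter (fun w => R z w)) 
          (Finset.univ.filter (fun w => R w z)) := by
      intro hdis
      have := Finset.card_union_of_disjoint hdis
      have h3 := Finset.card_le_univ ((Finset.univ.filter (fun w => R z w)) ∪ 
          (Finset.univ.filter (fun w => R w z)))
      omega
    rw [Finset.not_disjoint_iff] at hnd
    obtain ⟨w, hw1, hw2⟩ := hnd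
    obtain ⟨a, ha, az, av⟩ := (Finset.mem_filter.1 hw1).2
    have hb := (Finset.mem_filter.1 hw2).2
    rintro x y ⟨g, hg, rfl, rfl⟩
    have : R v z := by
      apply hR' a ha
      rw [av, az]; exact hb
    exact hR g hg _ _ this
  let Γ : α → α → Prop := fun x y => x ≠ y ∧ ¬ R x y
  have hΓ : ∀ g ∈ G, ∀ x y, Γ x y → Γ (g x) (g y) := by
    rintro g hg x y ⟨h, h'⟩
    exact ⟨fun e => h (g.injective e), fun e => h' (hR' g hg _ _ e)⟩
  have hΓs : ∀ x y, Γ x y → Γ y x := fun x y h => ⟨h.1.symm, fun e => h.2 (hRsymm _ _ e)⟩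
  set d := (Finset.univ.filter (fun w => Γ v w)).card with hd
  have hdz : ∀ x, (Finset.univ.filter (fun w => Γ x w)).card = d := fun x => by
    rw [hd]; convert outdeg G ht Γ hΓ x v
  have hdpos : 0 < d := by
    by_contra hc
    have hd0 : d = 0 := by omega
    apply h2t
    rw [MulAction.is_two_pretransitive_iff]
    intro a b c e hab hce
    have hall : ∀ x y, x ≠ y → R x y := by
      intro x y hxy
      by_contra hr
      have := hdz x
      rw [hd0, Finset.card_eq_zero, Finset.filter_eq_empty_iff] at this
      exact this (Finset.mem_univ y) ⟨hxy, hr⟩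
    obtain ⟨g, hg, rfl, rfl⟩ := hall a b hab
    obtain ⟨g', hg', rfl, rfl⟩ := hall c e hce
    refine ⟨⟨g' * g⁻¹, G.mul_mem hg' (G.inv_mem hg)⟩, ?_, ?_⟩
    · change (g' * g⁻¹) (g z) = g' z
      simp
    · change (g' * g⁻¹) (g v) = g' v
      simp
  have hcommon : ∃ u, Γ z u ∧ Γ u v := by
    by_contra hc
    have hc' : ∀ x u y, Γ x u → Γ u y → ¬ R x y := by
      rintro x u y h1 h2 ⟨g, hg, rfl, rfl⟩
      apply hc
      refine ⟨g⁻¹ u, ?_, ?_⟩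
      · have := hΓ g⁻¹ (G.inv_mem hg) _ _ h1
        simpa using this
      · have := hΓ g⁻¹ (G.inv_mem hg) _ _ h2
        simpa using this
    let r : Setoid α := ⟨fun x y => x = y ∨ Γ x y, fun x => Or.inl rfl, by
      rintro x y (h | h)
      · exact Or.inl h.symm
      · exact Or.inr (hΓs _ _ h), by
      rintro x y w (h | h) (h' | h')
      · exact Or.inl (h.trans h')
      · exact Or.inr (h ▸ h')
      · exact Or.inr (h' ▸ h)
      · by_cases hxw : x = w
        · exact Or.inl hxw
        · exact Or.inr ⟨hxw, hc' _ _ _ h h'⟩⟩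
    obtain ⟨w, hw⟩ := Finset.card_pos.1 hdpos
    have hw := (Finset.mem_filter.1 hw).2
    have := prim_setoid hprim r (by
      rintro ⟨g, hg⟩ x y (h | h)
      · exact Or.inl (by rw [h])
      · exact Or.inr (hΓ g hg _ _ h)) v w hw.1 (Or.inr hw) z v
    rcases this with h | h
    · exact hzv h
    · exact h.2 ⟨1, G.one_mem, rfl, rfl⟩
  obtain ⟨u, hu1, hu2⟩ := hcommon
  set n1 := (Finset.univ.filter (fun w => R z w)).card with hn1
  have hn1d : n1 ≤ d * (d - 1) := by
    have hsub : (Finset.univ.filter (fun w => R z w)) ⊆ (Finset.univ.filter (fun w => Γ z w)).biUnion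
        (fun u => (Finset.univ.filter (fun w => Γ u w)).erase z) := by
      intro w hw
      obtain ⟨g, hg, gz, gv⟩ := (Finset.mem_filter.1 hw).2
      rw [Finset.mem_biUnion]
      refine ⟨g u, ?_, ?_⟩
      · rw [Finset.mem_filter]
        refine ⟨Finset.mem_univ _, ?_⟩
        have := hΓ g hg _ _ hu1
        rwa [gz] at this
      · rw [Finset.mem_erase, Finset.mem_filter]
        refine ⟨?_, Finset.mem_univ _, ?_⟩
        · rintro rfl
          exact hRirr _ (Finset.mem_filter.1 hw).2
        · have := hΓ g hg _ _ hu2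
          rwa [gv] at this
    refine (Finset.card_le_card hsub).trans ?_
    have := Finset.card_biUnion_le_card_mul (Finset.univ.filter (fun w => Γ z w))
      (fun u => (Finset.univ.filter (fun w => Γ u w)).erase z) (d - 1) (by
        intro a ha
        rw [Finset.card_erase_of_mem, hdz]
        rw [Finset.mem_filter] at ha ⊢
        exact ⟨Finset.mem_univ _, hΓs _ _ ha.2⟩)
    rwa [hdz] at this
  have hsum : 1 + n1 + d = Fintype.card α := by
    rw [hn1, ← hdz z]
    have a1 := Finset.card_filter_add_card_filter_not (s := Finset.univ) (fun w => R z w)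
    have a2 : (Finset.univ.filter (fun w => ¬ R z w)) = 
        insert z (Finset.univ.filter (fun w => Γ z w)) := by
      ext w
      simp only [Finset.mem_filter, Finset.mem_univ, true_and, Finset.mem_insert]
      constructor
      · intro h
        by_cases e : w = z
        · exact Or.inl e
        · exact Or.inr ⟨fun e' => e e'.symm, h⟩
      · rintro (rfl | h)
        · exact hRirr _
        · exact h.2
    rw [a2, Finset.card_insert_of_notMem, Finset.card_univ] at a1
    · omega
    · intro h
      exact (Finset.mem_filter.1 h).2.1 rfl
  have hE := relE G ht Γ hΓ v C d (by rw [hd]; congr!) hC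
  set n := Fintype.card α
  obtain ⟨e, he⟩ : ∃ e, d = e + 1 := ⟨d - 1, by omega⟩
  rw [he] at hn1d hE hsum
  have hnd : n - (e + 1) = n1 + 1 := by omega
  have hn1' : n - 1 = n1 + e + 1 := by omega
  rw [hnd, hn1'] at hE
  simp only [Nat.add_sub_cancel] at hn1d
  have hz' : e + 2 < n1 := by omega
  rw [← hsum]
  clear_value n1 n
  exact num_srg C n1 e hC8 hn1d hE hz'
end

end PG

open Equiv
open scoped Pointwise

namespace PG

lemma uni_final {α : Type*} [Fintype α] [DecidableEq α] {p : ℕ} (hp : p.Prime)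
    (G : Subgroup (Perm α)) (hG : ¬ p ∣ Nat.card G) (hprim : MulAction.IsPreprimitive G α)
    (h2t : ¬ MulAction.IsMultiplyPretransitive G α 2) (hn : 2 ≤ Fintype.card α) (v : α)
    (g : Perm α) (hg : g ∈ G) (h1 : g ≠ 1) (h4 : 4 ≤ g.support.card) (hk : 3 ≤ kk (stb G v))
    (hlt : p ^ (2 * kk (stb G v) + g.support.card) < p ^ 4 * Fintype.card α ^ 2) : False := by
  rcases hp.eq_two_or_odd' with rfl | hodd
  · refine uni2 G hG hprim g.support.card h4 v g hg h1 (le_of_eq ?_) hn hk hlt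
    congr!
  · have hp3 : 3 ≤ p := by
      have := hp.two_le
      rcases hodd with ⟨r, hr⟩
      omega
    set m := g.support.card with hm
    obtain ⟨y, hy⟩ : ∃ y, kk (stb G v) = y + 1 := ⟨kk (stb G v) - 1, by omega⟩
    have hC := diam G hprim m v g hg h1 le_rfl 1 (fun i => cB_step G m v i) y (by omega)
    have h5 := uni3_bound G hprim h2t v (y * m) (by nlinarith) hn (by
      intro w
      obtain ⟨f, hf, e, hs⟩ := hC w
      refine ⟨f, hf, e, le_trans (le_of_eq ?_) hs⟩
      congr!)
    have h6 := num3 _ m y h4 (by omega) h5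
    rw [hy, show 2 * (y + 1) + m = 4 + (m + 2 * y - 2) by omega, pow_add] at hlt
    have h7 := lt_of_mul_lt_mul_left hlt (Nat.zero_le _)
    have h8 : 3 ^ (m + 2 * y - 2) ≤ p ^ (m + 2 * y - 2) := Nat.pow_le_pow_left hp3 _
    rw [show m + 2 * y = (m + 2 * y - 2) + 2 by omega, pow_add] at h6
    omega

lemma orbit_count {Γ β : Type*} [Group Γ] [Fintype Γ] [DecidableEq β] [MulAction Γ β]
    (x : β) (T : Finset β) (hT : ∀ h : Γ, h • x ∈ T) (htr : ∀ y ∈ T, ∃ h : Γ, h • x = y)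
    (y : β) (hy : y ∈ T) :
    T.card * (Finset.univ.filter (fun h : Γ => h • x = y)).card = Fintype.card Γ := by
  have hc : ∀ w ∈ T, (Finset.univ.filter (fun h : Γ => h • x = w)).card =
      (Finset.univ.filter (fun h : Γ => h • x = y)).card := by
    intro w hw
    obtain ⟨a, rfl⟩ := htr w hw
    obtain ⟨b, rfl⟩ := htr y hy
    apply Finset.card_bij (fun h _ => b * a⁻¹ * h)
    · intro h hh
      simp only [Finset.mem_filter, Finset.mem_univ, true_and] at hh ⊢
      rw [mul_smul, hh, mul_smul, inv_smul_smul]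
    · intro h _ k _ e; exact mul_left_cancel e
    · intro h hh
      simp only [Finset.mem_filter, Finset.mem_univ, true_and] at hh
      refine ⟨a * b⁻¹ * h, ?_, by group⟩
      simp only [Finset.mem_filter, Finset.mem_univ, true_and]
      rw [mul_smul, hh, mul_smul, inv_smul_smul]
  have := Finset.card_eq_sum_card_fiberwise (s := (Finset.univ : Finset Γ)) (f := fun h : Γ => h • x)
    (t := T) (fun h _ => hT h)
  rw [Finset.card_univ] at this
  rw [this, Finset.sum_congr rfl hc, Finset.sum_const, smul_eq_mul]

lemma avg {Γ β : Type*} [Group Γ] [Fintype Γ] [DecidableEq β] [MulAction Γ β]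
    (T U V : Finset β) (hT : ∀ h : Γ, ∀ x ∈ T, h • x ∈ T)
    (htr : ∀ x ∈ T, ∀ y ∈ T, ∃ h : Γ, h • x = y) (hU : U ⊆ T) (hV : V ⊆ T) :
    T.card * ∑ h : Γ, (U.filter (fun u => h • u ∈ V)).card = U.card * V.card * Fintype.card Γ := by
  have e : ∀ h : Γ, (U.filter (fun u => h • u ∈ V)).card =
      ∑ u ∈ U, ∑ v ∈ V, if h • u = v then 1 else 0 := by
    intro h
    rw [Finset.card_filter]
    apply Finset.sum_congr rfl
    intro u _
    rw [Finset.sum_ite_eq]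
  simp only [e]
  rw [Finset.sum_comm, Finset.mul_sum]
  have : ∀ u ∈ U, T.card * ∑ h : Γ, ∑ v ∈ V, (if h • u = v then 1 else 0) =
      V.card * Fintype.card Γ := by
    intro u hu
    rw [Finset.sum_comm, Finset.mul_sum]
    rw [Finset.sum_congr rfl (g := fun _ => Fintype.card Γ)]
    · rw [Finset.sum_const, smul_eq_mul]
    · intro v hv
      rw [← Finset.card_filter]
      exact orbit_count u T (fun h => hT h u (hU hu)) (htr u (hU hu)) v (hV hv)
  rw [Finset.sum_congr rfl this, Finset.sum_const, smul_eq_mul, mul_assoc]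

lemma mindeg2 {α : Type*} [Fintype α] [DecidableEq α] (G : Subgroup (Perm α))
    (h2t : MulAction.IsMultiplyPretransitive G α 2) (g : Perm α) (hg : g ∈ G)
    (m : ℕ) (hm : g.support.card = m) (h4 : 4 ≤ m)
    (hmin : ∀ f ∈ G, f ≠ 1 → m ≤ f.support.card) :
    Fintype.card α ≤ 1 + (m - 1) ^ 2 ∧
    (m + 2) / 3 * (Fintype.card α - m) ≤ (m - 1) ^ 2 + (Fintype.card α - 1) := by
  classical
  rw [MulAction.is_two_pretransitive_iff] at h2t
  set S := g.support with hS
  set n := Fintype.card α with hn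
  have hmn : m ≤ n := by rw [← hm]; exact Finset.card_le_univ _
  let Z : G → ℕ := fun h => (S.filter (fun a => h • a ∈ S)).card
  let W : G → ℕ := fun h => (S.filter (fun a => h • a ∈ S ∧ h • (g a) ∉ S)).card
  set N := Fintype.card G with hN
  have hNpos : 0 < N := Fintype.card_pos
  have hWZ : ∀ h, W h ≤ Z h := fun h => Finset.card_le_card (by
    intro a ha
    rw [Finset.mem_filter] at ha ⊢
    exact ⟨ha.1, ha.2.1⟩)
  have hZ3 : ∀ h, 0 < W h → m ≤ 3 * Z h := by
    intro h hw
    obtain ⟨a, ha⟩ := Finset.card_pos.1 hw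
    rw [Finset.mem_filter] at ha
    obtain ⟨ha, ha1, ha2⟩ := ha
    let k : Perm α := (h : Perm α)⁻¹ * g * (h : Perm α)
    have hk : k ∈ G := G.mul_mem (G.mul_mem (G.inv_mem h.2) hg) h.2
    have hks : ∀ x, k x = x ↔ g ((h : Perm α) x) = (h : Perm α) x := by
      intro x
      change (h : Perm α)⁻¹ (g ((h : Perm α) x)) = x ↔ _
      rw [Perm.inv_eq_iff_eq]
    have hne := comm_ne_one g k a (by
      rw [Ne, hks]; exact Perm.mem_support.1 ha1) (by
      rw [hks]; exact Perm.notMem_support.1 ha2)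
    have h5 := hmin _ (G.mul_mem (G.mul_mem (G.mul_mem hg hk) (G.inv_mem hg)) (G.inv_mem hk)) hne
    have h6 := comm_supp g k
    have h7 : g.support ∩ k.support = S.filter (fun a => h • a ∈ S) := by
      ext x
      rw [Finset.mem_inter, Finset.mem_filter, Perm.mem_support (f := k), Ne, hks]
      have : (h • x ∈ S) ↔ ¬ g ((h : Perm α) x) = (h : Perm α) x := Perm.mem_support
      rw [this]
    rw [h7] at h6
    exact h5.trans h6
  have hZ1 : ∀ h, Z h ≠ 1 := by
    intro h hz
    have := hZ3 h (by
      obtain ⟨a, ha⟩ := Finset.card_eq_one.1 hz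
      have haS : a ∈ S.filter (fun a => h • a ∈ S) := by rw [ha]; exact Finset.mem_singleton_self _
      rw [Finset.mem_filter] at haS
      apply Finset.card_pos.2
      refine ⟨a, ?_⟩
      rw [Finset.mem_filter]
      refine ⟨haS.1, haS.2, ?_⟩
      intro hga
      have : g a ∈ S.filter (fun a => h • a ∈ S) := by
        rw [Finset.mem_filter]
        exact ⟨Perm.apply_mem_support.2 haS.1, hga⟩
      rw [ha, Finset.mem_singleton] at this
      exact Perm.mem_support.1 haS.1 this)
    omega
  have htr1 : ∀ x y : α, ∃ h : G, h • x = y := by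
    intro x y
    have : Nontrivial α := by
      rw [← Fintype.one_lt_card_iff_nontrivial]; omega
    obtain ⟨x', hx'⟩ := exists_ne x
    obtain ⟨y', hy'⟩ := exists_ne y
    obtain ⟨h, hh, _⟩ := h2t hx'.symm hy'.symm
    exact ⟨h, hh⟩
  have E1 : n * ∑ h, Z h = m * m * N := by
    have := avg (Γ := G) (Finset.univ : Finset α) S S (by simp) (fun x _ y _ => htr1 x y)
      (Finset.subset_univ _) (Finset.subset_univ _)
    rwa [hm, Finset.card_univ] at this
  have hToff : ∀ h : G, ∀ x ∈ (Finset.univ : Finset α).offDiag, 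
      h • x ∈ (Finset.univ : Finset α).offDiag := by
    rintro h ⟨x, y⟩ hx
    rw [Finset.mem_offDiag] at hx
    simp only [Prod.smul_mk, Finset.mem_offDiag, Finset.mem_univ, true_and]
    exact fun e => hx.2.2 (MulAction.injective h e)
  have htroff : ∀ x ∈ (Finset.univ : Finset α).offDiag, ∀ y ∈ (Finset.univ : Finset α).offDiag, 
      ∃ h : G, h • x = y := by
    rintro ⟨x, x'⟩ hx ⟨y, y'⟩ hy
    rw [Finset.mem_offDiag] at hx hy
    obtain ⟨h, h1, h2⟩ := h2t hx.2.2 hy.2.2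
    exact ⟨h, by rw [Prod.smul_mk, h1, h2]⟩
  have E2 : (n * n - n) * ∑ h, (Z h * Z h - Z h) = (m * m - m) * (m * m - m) * N := by
    have := avg (Γ := G) (Finset.univ : Finset α).offDiag S.offDiag S.offDiag hToff htroff 
      (Finset.offDiag_mono (Finset.subset_univ _)) (Finset.offDiag_mono (Finset.subset_univ _))
    rw [Finset.offDiag_card, Finset.offDiag_card, hm, Finset.card_univ] at this
    rw [← this]
    congr 1
    apply Finset.sum_congr rfl
    intro h _
    rw [← Finset.offDiag_card]
    congr 1
    ext ⟨x, y⟩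
    simp only [Finset.mem_offDiag, Finset.mem_filter, Prod.smul_mk]
    constructor
    · rintro ⟨⟨a, b⟩, ⟨c, d⟩, e⟩
      exact ⟨⟨a, c, e⟩, b, d, fun e' => e (MulAction.injective h e')⟩
    · rintro ⟨⟨a, c, e⟩, b, d, -⟩
      exact ⟨⟨a, b⟩, ⟨c, d⟩, e⟩
  have E3 : (n * n - n) * ∑ h, W h = m * (m * (n - m)) * N := by
    have hinj : Function.Injective (fun a : α => (a, g a)) := fun a b e => (Prod.mk.inj e).1
    have := avg (Γ := G) (Finset.univ : Finset α).offDiag (S.image (fun a => (a, g a))) (S ×ˢ Sᶜ)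
      hToff htroff (by
        intro x hx
        rw [Finset.mem_image] at hx
        obtain ⟨a, ha, rfl⟩ := hx
        simp only [Finset.mem_offDiag, Finset.mem_univ, true_and]
        exact (Perm.mem_support.1 ha).symm) (by
        rintro ⟨x, y⟩ hx
        simp only [Finset.mem_product, Finset.mem_compl] at hx
        simp only [Finset.mem_offDiag, Finset.mem_univ, true_and]
        rintro rfl
        exact hx.2 hx.1)
    rw [Finset.offDiag_card, Finset.card_product, Finset.card_compl, 
      Finset.card_image_of_injective _ hinj, hm, Finset.card_univ] at this
    rw [← this]
    congr 1
    apply Finset.sum_congr rfl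
    intro h _
    rw [Finset.filter_image, Finset.card_image_of_injective _ hinj]
    apply congrArg Finset.card
    ext x
    simp only [Finset.mem_filter, Prod.smul_mk, Finset.mem_product, Finset.mem_compl]
  set ZZ := ∑ h, (Z h * Z h - Z h) with hZZ
  set Z1 := ∑ h, Z h with hZ1s
  set W1 := ∑ h, W h with hW1
  have I1 : Z1 ≤ ZZ := by
    apply Finset.sum_le_sum
    intro h _
    have := hZ1 h
    generalize Z h = z at *
    rcases z with _ | _ | z
    · simp
    · omega
    · apply Nat.le_sub_of_add_le; nlinarith
  have I2 : (m + 2) / 3 * W1 ≤ ZZ + Z1 := by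
    rw [hW1, hZZ, hZ1s, Finset.mul_sum, ← Finset.sum_add_distrib]
    apply Finset.sum_le_sum
    intro h _
    have a1 : Z h ≤ Z h * Z h := Nat.le_mul_self _
    rw [Nat.sub_add_cancel a1]
    rcases Nat.eq_zero_or_pos (W h) with h0 | h0
    · rw [h0]; simp
    · have := hZ3 h h0
      exact Nat.mul_le_mul (by omega) (hWZ h)
  obtain ⟨a, ha⟩ : ∃ a, m = a + 1 := ⟨m - 1, by omega⟩
  obtain ⟨b, hb⟩ : ∃ b, n = b + 1 := ⟨n - 1, by omega⟩
  have e1 : n * n - n = n * b := by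
    rw [hb, Nat.mul_add, Nat.mul_one, Nat.add_sub_cancel]
  have e2 : m * m - m = m * a := by
    rw [ha, Nat.mul_add, Nat.mul_one, Nat.add_sub_cancel]
  rw [e1, e2] at E2
  rw [e1] at E3
  have hnp : 0 < n := by omega
  have hmp : 0 < m * m * N := by positivity
  have ea : m - 1 = a := by omega
  have eb : n - 1 = b := by omega
  rw [ea, eb]
  have F1 : n * b * Z1 = m * m * N * b := by
    rw [mul_right_comm, E1]
  have F2 : n * b * ZZ = m * m * N * a ^ 2 := by rw [E2]; ring
  have F3 : n * b * W1 = m * m * N * (n - m) := by rw [E3]; ring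
  constructor
  · have : m * m * N * b ≤ m * m * N * a ^ 2 := by
      rw [← F1, ← F2]; exact Nat.mul_le_mul_left _ I1
    have := Nat.le_of_mul_le_mul_left this hmp
    omega
  · have : m * m * N * ((m + 2) / 3 * (n - m)) ≤ m * m * N * (a ^ 2 + b) := by
      rw [mul_add, ← F1, ← F2, mul_left_comm, ← F3, mul_left_comm, ← mul_add]
      exact Nat.mul_le_mul_left _ I2
    exact Nat.le_of_mul_le_mul_left this hmp

end PG

open Equiv
open scoped Pointwise

namespace PG

/-- table for small degrees -/
lemma tab (n m : ℕ) (h4 : 4 ≤ m) (hmn : m ≤ n) (ha : n ≤ 1 + (m - 1) ^ 2)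
    (hb : (m + 2) / 3 * (n - m) ≤ (m - 1) ^ 2 + (n - 1)) (hm : m ≤ 8) :
    (m = 4 ∧ n ≤ 10) ∨ (m = 5 ∧ n ≤ 17) ∨ (m = 6 ∧ n ≤ 26) ∨ (m = 7 ∧ n ≤ 28) ∨
      (m = 8 ∧ n ≤ 36) := by
  interval_cases m <;> norm_num at * <;> omega

lemma big_n (n m : ℕ) (h4 : 4 ≤ m) (hmn : m ≤ n) (ha : n ≤ 1 + (m - 1) ^ 2)
    (hb : (m + 2) / 3 * (n - m) ≤ (m - 1) ^ 2 + (n - 1)) (hn : 50 ≤ n) :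
    9 ≤ m ∧ n ≤ 4 * m + 9 := by
  have h9 : 9 ≤ m := by
    by_contra hc
    have := tab n m h4 hmn ha hb (by omega)
    omega
  refine ⟨h9, ?_⟩
  obtain ⟨r, rfl⟩ := Nat.exists_eq_add_of_le hmn
  obtain ⟨a, rfl⟩ : ∃ a, m = a + 1 := ⟨m - 1, by omega⟩
  have e1 : a + 1 + r - (a + 1) = r := by omega
  have e2 : a + 1 + r - 1 = a + r := by omega
  have e3 : a + 1 - 1 = a := by omega
  rw [e1, e2, e3] at hb
  have hz : a + 1 ≤ 3 * ((a + 1 + 2) / 3) := by omega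
  generalize (a + 1 + 2) / 3 = z at *
  have : (a + 1) * r ≤ 3 * (a ^ 2 + (a + r)) := by nlinarith
  nlinarith

lemma num_p3 (n m : ℕ) (h4 : 4 ≤ m) (hmn : m ≤ n) (ha : n ≤ 1 + (m - 1) ^ 2)
    (hb : (m + 2) / 3 * (n - m) ≤ (m - 1) ^ 2 + (n - 1))
    (hlt : 3 ^ (m + 6) < (n.descFactorial 2) ^ 2) : False := by
  have hd : ∀ N, n ≤ N → (n.descFactorial 2) ^ 2 ≤ (N.descFactorial 2) ^ 2 := fun N h =>
    Nat.pow_le_pow_left (Nat.descFactorial_le 2 h) 2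
  rcases Nat.lt_or_ge n 50 with h50 | h50
  · rcases Nat.lt_or_ge m 9 with h9 | h9
    · rcases tab n m h4 hmn ha hb (by omega) with ⟨rfl, h⟩ | ⟨rfl, h⟩ | ⟨rfl, h⟩ | ⟨rfl, h⟩ | ⟨rfl, h⟩ <;>
      · have := hd _ h
        norm_num [Nat.descFactorial] at this hlt
        omega
    · have := hd 49 (by omega)
      have h2 : 3 ^ (9 + 6) ≤ 3 ^ (m + 6) := Nat.pow_le_pow_right (by norm_num) (by omega)
      norm_num [Nat.descFactorial] at this h2 hlt
      omega
  · obtain ⟨h9, h10⟩ := big_n n m h4 hmn ha hb h50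
    have h1 : (n.descFactorial 2) ^ 2 ≤ (4 * m + 9) ^ 4 := by
      rw [show (4 * m + 9) ^ 4 = ((4 * m + 9) ^ 2) ^ 2 by ring]
      exact Nat.pow_le_pow_left ((Nat.descFactorial_le_pow n 2).trans (Nat.pow_le_pow_left h10 2)) 2
    have h2 : ∀ m, 9 ≤ m → (4 * m + 9) ^ 4 ≤ 3 ^ (m + 6) := by
      intro m hm
      induction m, hm using Nat.le_induction with
      | base => norm_num
      | succ m hm ih =>
        rw [show m + 1 + 6 = (m + 6) + 1 by ring, pow_succ 3]
        have a1 : 45 * (4 * (m + 1) + 9) ≤ 49 * (4 * m + 9) := by omega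
        have a2 := Nat.pow_le_pow_left a1 4
        rw [mul_pow, mul_pow] at a2
        norm_num at a2
        omega
    have := h2 m h9
    omega

lemma num_p5 (n m t : ℕ) (h4 : 4 ≤ m) (hmn : m ≤ n) (ha : n ≤ 1 + (m - 1) ^ 2)
    (hb : (m + 2) / 3 * (n - m) ≤ (m - 1) ^ 2 + (n - 1)) (hn : 26 ≤ n)
    (ht : t = 2 ∧ 5 ^ (m + 4) < (n.descFactorial t) ^ 2 ∨ t = 3 ∧ 5 ^ (m + 6) < (n.descFactorial t) ^ 2
      ∨ t = 4 ∧ 5 ^ (m + 14) < (n.descFactorial t) ^ 2) : False := by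
  have hd : ∀ N, n ≤ N → (n.descFactorial t) ^ 2 ≤ (N.descFactorial t) ^ 2 := fun N h =>
    Nat.pow_le_pow_left (Nat.descFactorial_le t h) 2
  rcases Nat.lt_or_ge n 50 with h50 | h50
  · rcases Nat.lt_or_ge m 9 with h9 | h9
    · rcases tab n m h4 hmn ha hb (by omega) with ⟨rfl, h⟩ | ⟨rfl, h⟩ | ⟨rfl, h⟩ | ⟨rfl, h⟩ | ⟨rfl, h⟩
      · omega
      · omega
      all_goals
        have := hd _ h
        rcases ht with ⟨rfl, hlt⟩ | ⟨rfl, hlt⟩ | ⟨rfl, hlt⟩ <;>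
        · norm_num [Nat.descFactorial] at this hlt
          omega
    · have := hd 49 (by omega)
      have h2 : 5 ^ 9 ≤ 5 ^ m := Nat.pow_le_pow_right (by norm_num) (by omega)
      rcases ht with ⟨rfl, hlt⟩ | ⟨rfl, hlt⟩ | ⟨rfl, hlt⟩ <;>
      · rw [pow_add] at hlt
        norm_num [Nat.descFactorial] at this hlt h2
        omega
  · obtain ⟨h9, h10⟩ := big_n n m h4 hmn ha hb h50
    have h11 : 11 ≤ m := by omega
    have h1 : (n.descFactorial t) ^ 2 ≤ (4 * m + 9) ^ (t * 2) := by
      rw [pow_mul]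
      exact Nat.pow_le_pow_left ((Nat.descFactorial_le_pow n t).trans (Nat.pow_le_pow_left h10 t)) 2
    have hs : ∀ m, 11 ≤ m → 53 * (4 * (m + 1) + 9) ≤ 57 * (4 * m + 9) := by intro m hm; omega
    rcases ht with ⟨rfl, hlt⟩ | ⟨rfl, hlt⟩ | ⟨rfl, hlt⟩
    · have h2 : ∀ m, 11 ≤ m → (4 * m + 9) ^ 4 ≤ 5 ^ (m + 4) := by
        intro m hm
        induction m, hm using Nat.le_induction with
        | base => norm_num
        | succ m hm ih =>
          rw [show m + 1 + 4 = (m + 4) + 1 by ring, pow_succ 5]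
          have a2 := Nat.pow_le_pow_left (hs m hm) 4
          rw [mul_pow, mul_pow] at a2
          norm_num at a2
          omega
      have := h2 m h11
      exact absurd (h1.trans this) (not_le.2 hlt)
    · have h2 : ∀ m, 11 ≤ m → (4 * m + 9) ^ 6 ≤ 5 ^ (m + 6) := by
        intro m hm
        induction m, hm using Nat.le_induction with
        | base => norm_num
        | succ m hm ih =>
          rw [show m + 1 + 6 = (m + 6) + 1 by ring, pow_succ 5]
          have a2 := Nat.pow_le_pow_left (hs m hm) 6
          rw [mul_pow, mul_pow] at a2
          norm_num at a2
          omega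
      have := h2 m h11
      exact absurd (h1.trans this) (not_le.2 hlt)
    · have h2 : ∀ m, 11 ≤ m → (4 * m + 9) ^ 8 ≤ 5 ^ (m + 14) := by
        intro m hm
        induction m, hm using Nat.le_induction with
        | base => norm_num
        | succ m hm ih =>
          rw [show m + 1 + 14 = (m + 14) + 1 by ring, pow_succ 5]
          have a2 := Nat.pow_le_pow_left (hs m hm) 8
          rw [mul_pow, mul_pow] at a2
          norm_num at a2
          omega
      have := h2 m h11
      exact absurd (h1.trans this) (not_le.2 hlt)

lemma log_ge_one (p : ℕ) (hp : 3 ≤ p) : 1 ≤ Real.log p := by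
  rw [Real.le_log_iff_exp_le (by positivity)]
  have := Real.exp_one_lt_d9
  have : (3 : ℝ) ≤ p := by exact_mod_cast hp
  linarith

lemma log_n_le (p n : ℕ) (hp : 3 ≤ p) (hn : 0 < n) :
    Real.log n ≤ 2 * Real.log p + ((n : ℝ) / p ^ 2 - 1) := by
  have hp0 : (0 : ℝ) < p := by positivity
  have hn0 : (0 : ℝ) < n := by positivity
  have h1 := Real.log_le_sub_one_of_pos (show (0 : ℝ) < n / p ^ 2 by positivity)
  rw [Real.log_div hn0.ne' (by positivity), Real.log_pow] at h1
  push_cast at h1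
  linarith

lemma lt_log (p n a b : ℕ) (hp : 3 ≤ p) (h : p ^ a < n ^ b) (hn : 0 < n) :
    (a : ℝ) * Real.log p < b * Real.log n := by
  have hp0 : (0 : ℝ) < p := by positivity
  have hn0 : (0 : ℝ) < n := by positivity
  rw [← Real.log_pow, ← Real.log_pow]
  apply Real.log_lt_log (by positivity)
  exact_mod_cast h

lemma num_reg (p n : ℕ) (hp : 3 ≤ p) (hn : p ^ 2 < n) : n ^ (p - 1) < p ^ (n - 1) := by
  by_contra hc
  push Not at hc
  have hn0 : 0 < n := by omega
  have hc2 : p ^ (n - 1) < n ^ (p - 1) * 1 + 1 := by omega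
  have hl : ((n - 1 : ℕ) : ℝ) * Real.log p ≤ (p - 1 : ℕ) * Real.log n := by
    have hp0 : (0 : ℝ) < p := by positivity
    rw [← Real.log_pow, ← Real.log_pow]
    apply Real.log_le_log (by positivity)
    exact_mod_cast hc
  have h1 := log_ge_one p hp
  have h2 := log_n_le p n hp hn0
  rw [Nat.cast_sub (by omega), Nat.cast_sub (by omega)] at hl
  have hp3 : (3 : ℝ) ≤ p := by exact_mod_cast hp
  have hnr : (p : ℝ) ^ 2 < n := by exact_mod_cast hn
  obtain ⟨c, hcdef⟩ : ∃ c : ℝ, c = n / p ^ 2 := ⟨_, rfl⟩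
  have hcn : (n : ℝ) = c * p ^ 2 := by rw [hcdef]; field_simp
  rw [← hcdef] at h2
  have hc1 : 1 < c := by
    rw [hcdef, lt_div_iff₀ (by positivity)]; linarith
  set l := Real.log p
  have h3 : Real.log n ≤ (c + 1) * l := by nlinarith
  have h4 : (c * p ^ 2 - 1) * l ≤ ((p : ℝ) - 1) * ((c + 1) * l) := by
    rw [← hcn]
    push_cast at hl
    refine hl.trans ?_
    apply mul_le_mul_of_nonneg_left h3; linarith
  have h5 : c * p ^ 2 - 1 ≤ ((p : ℝ) - 1) * (c + 1) := by
    apply le_of_mul_le_mul_right (a := l) _ (by linarith)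
    linarith
  nlinarith

lemma num_big (p n m t : ℕ) (hp : 7 ≤ p) (hn : p ^ 2 < n) (h10 : n ≤ 4 * m + 9) (ht : 2 ≤ t)
    (h : t ≤ p - 2 ∧ p ^ (m + 2 * t) < n ^ (2 * t) ∨ 
      t = p - 1 ∧ p ^ (m + 4 * t - 2) < n ^ (2 * t)) : False := by
  have hn0 : 0 < n := by omega
  have h1 := log_ge_one p (by omega)
  have h2 := log_n_le p n (by omega) hn0
  have hp3 : (7 : ℝ) ≤ p := by exact_mod_cast hp
  have hnr : (p : ℝ) ^ 2 < n := by exact_mod_cast hn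
  have hnm : (n : ℝ) ≤ 4 * m + 9 := by exact_mod_cast h10
  have htr : (2 : ℝ) ≤ t := by exact_mod_cast ht
  obtain ⟨c, hcdef⟩ : ∃ c : ℝ, c = n / p ^ 2 := ⟨_, rfl⟩
  have hcn : (n : ℝ) = c * p ^ 2 := by rw [hcdef]; field_simp
  rw [← hcdef] at h2
  have hc1 : 1 < c := by
    rw [hcdef, lt_div_iff₀ (by positivity)]; linarith
  rw [hcn] at hnm
  rcases h with ⟨h3, h4⟩ | ⟨h3, h4⟩
  · have h5 := lt_log p n _ _ (by omega) h4 hn0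
    push_cast at h5
    set l := Real.log p
    have h6 : ((m : ℝ) + 2 * t) * l < 2 * t * (2 * l + (c - 1)) := by
      refine lt_of_lt_of_le h5 ?_
      apply mul_le_mul_of_nonneg_left h2; linarith
    have h7 : (m : ℝ) < 2 * t * c := by
      by_contra hcon
      push Not at hcon
      have : 0 ≤ (m - 2 * t : ℝ) := by nlinarith
      nlinarith
    have h8 : (t : ℝ) ≤ p - 2 := by
      have : t + 2 ≤ p := by omega
      have : (t : ℝ) + 2 ≤ p := by exact_mod_cast this
      linarith
    have h9 : (m : ℝ) < 2 * (p - 2) * c := by nlinarith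
    have h11 : c * (p - 4 : ℝ) ^ 2 < 9 := by nlinarith
    have h12 : (9 : ℝ) ≤ (p - 4 : ℝ) ^ 2 := by nlinarith
    nlinarith
  · have h5 := lt_log p n _ _ (by omega) h4 hn0
    rw [Nat.cast_sub (by omega)] at h5
    push_cast at h5
    set l := Real.log p
    have h6 : ((m : ℝ) + 4 * t - 2) * l < 2 * t * (2 * l + (c - 1)) := by
      refine lt_of_lt_of_le h5 ?_
      apply mul_le_mul_of_nonneg_left h2; linarith
    have h7 : (m : ℝ) - 2 < 2 * t * (c - 1) := by
      by_contra hcon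
      push Not at hcon
      have : 0 ≤ (m - 2 : ℝ) := by nlinarith
      nlinarith
    have h8 : (t : ℝ) = p - 1 := by
      have : t + 1 = p := by omega
      have : (t : ℝ) + 1 = p := by exact_mod_cast this
      linarith
    rw [h8] at h7
    have h11 : c * ((p : ℝ) ^ 2 - 8 * p + 8) + 8 * p - 25 < 0 := by nlinarith
    have h12 : (1 : ℝ) ≤ (p : ℝ) ^ 2 - 8 * p + 8 := by nlinarith
    nlinarith

end PG

open Equiv
open scoped Pointwise

namespace PG

lemma prim_contra {α : Type} [Fintype α] [DecidableEq α] {p : ℕ} (hp : p.Prime)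
    (IH : ∀ (β : Type) [Finite β], Nat.card β < Nat.card α → Good p β)
    (G : Subgroup (Perm α)) (hG : ¬ p ∣ Nat.card G) (hn : 2 ≤ Nat.card α)
    (hprim : MulAction.IsPreprimitive G α) (hpn : p ≤ Nat.card α)
    (hbig : p ^ (Nat.card α - 1) ≤ Nat.card G) : False := by
  have h4 : ∀ g ∈ G, g ≠ 1 → 4 ≤ g.support.card := fun g hg h1 =>
    (min4 hp G hG hprim hpn hbig g hg h1).2
  obtain ⟨t, ht1, htp, htt, htn, hx⟩ := prim_data hp IH G hG hprim hpn hbig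
  have hcard : Nat.card α = Fintype.card α := Nat.card_eq_fintype_card
  rcases Nat.lt_or_ge t 2 with ht | ht
  · obtain rfl : t = 1 := by omega
    obtain ⟨v⟩ : Nonempty α := by
      rw [← Fintype.card_pos_iff]; omega
    obtain ⟨h1, -, h3⟩ := hx ⟨fun _ => v, fun a b _ => Subsingleton.elim a b⟩
    rcases h3 with h3 | ⟨g, hg, hg1, hlt⟩
    · rw [Nat.descFactorial_one] at h3
      rw [h3] at hbig hG
      set n := Nat.card α
      have h5 : 2 ^ (n - 1) ≤ n := le_trans (Nat.pow_le_pow_left hp.two_le _) hbig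
      have h6 : n = 2 := by
        by_contra hc
        have : ∀ k, 2 ≤ k → k + 1 < 2 ^ k := by
          intro k hk
          induction k, hk using Nat.le_induction with
          | base => norm_num
          | succ k hk ih => rw [pow_succ]; omega
        have := this (n - 1) (by omega)
        omega
      rw [h6] at hbig hG
      norm_num at hbig
      have : p = 2 := le_antisymm hbig hp.two_le
      exact hG (by rw [this])
    · rw [Nat.descFactorial_one, hcard] at hlt
      exact uni_final hp G hG hprim htn (by omega) v g hg hg1 (h4 g hg hg1) h1 hlt
  · have hp3 : 3 ≤ p := by omega
    have hnp : p ^ 2 < Nat.card α := by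
      by_contra hc
      have := bochert_card G h4
      have := boch_num (Nat.card α) p hp3 hn (by omega)
      omega
    have hx0 : Nonempty (Fin t ↪ α) := by
      apply Function.Embedding.nonempty_of_card_le
      rw [Fintype.card_fin]; omega
    obtain ⟨x⟩ := hx0
    obtain ⟨h1, h2, h3⟩ := hx x
    rcases h3 with h3 | ⟨g, hg, hg1, hlt⟩
    · have h5 := num_reg p _ hp3 hnp
      have h6 := Nat.descFactorial_le_pow (Nat.card α) t
      have h7 : Nat.card α ^ t ≤ Nat.card α ^ (p - 1) := Nat.pow_le_pow_right (by omega) (by omega)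
      omega
    · -- minimal degree
      classical
      obtain ⟨g0, hg0, hmin⟩ := Finset.exists_min_image
        (Finset.univ.filter (fun f : Perm α => f ∈ G ∧ f ≠ 1)) (fun f => f.support.card)
        ⟨g, by simp [hg, hg1]⟩
      simp only [Finset.mem_filter, Finset.mem_univ, true_and] at hg0 hmin
      have h2t : MulAction.IsMultiplyPretransitive G α 2 :=
        MulAction.isMultiplyPretransitive_of_le (n := t) ht (by rw [Nat.card_eq_fintype_card]; omega)
      have hmd := mindeg2 G h2t g0 hg0.1 _ rfl (h4 g0 hg0.1 hg0.2) (fun f hf hf1 => hmin f ⟨hf, hf1⟩)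
      have hm4 := h4 g0 hg0.1 hg0.2
      have hmn : g0.support.card ≤ Nat.card α := by rw [hcard]; exact Finset.card_le_univ _
      rw [← hcard] at hmd
      have hle := hmin g ⟨hg, hg1⟩
      set n := Nat.card α
      generalize g0.support.card = m at *
      obtain ⟨ha, hb⟩ := hmd
      set k := kk (ptw G x)
      have hlow : ∀ e, e + 4 ≤ 2 * k + m → p ^ e < (n.descFactorial t) ^ 2 := by
        intro e he
        have h5 : p ^ (e + 4) ≤ p ^ (2 * k + g.support.card) :=
          Nat.pow_le_pow_right (by omega) (by omega)
        have h6 := lt_of_le_of_lt h5 hlt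
        rw [pow_add, mul_comm] at h6
        exact lt_of_mul_lt_mul_left h6 (Nat.zero_le _)
      rcases Nat.lt_or_ge p 7 with h7 | h7
      · have hp' : p = 3 ∨ p = 5 := by
          interval_cases p
          · exact Or.inl rfl
          · exact absurd hp (by norm_num)
          · exact Or.inr rfl
          · exact absurd hp (by norm_num)
        rcases hp' with rfl | rfl
        · obtain rfl : t = 2 := by omega
          have := h2 (by omega)
          exact num_p3 n m hm4 hmn ha hb (hlow _ (by omega))
        · refine num_p5 n m t hm4 hmn ha hb (by omega) ?_
          have : t = 2 ∨ t = 3 ∨ t = 4 := by omega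
          rcases this with h | h | h
          · exact Or.inl ⟨h, hlow _ (by omega)⟩
          · exact Or.inr (Or.inl ⟨h, hlow _ (by omega)⟩)
          · have := h2 (by omega)
            exact Or.inr (Or.inr ⟨h, hlow _ (by omega)⟩)
      · have hn50 : 50 ≤ n := by nlinarith
        have hbn := big_n n m hm4 hmn ha hb hn50
        have hpw : (n.descFactorial t) ^ 2 ≤ n ^ (2 * t) := by
          rw [mul_comm, pow_mul]
          exact Nat.pow_le_pow_left (Nat.descFactorial_le_pow n t) 2
        refine num_big p n m t h7 hnp hbn.2 ht ?_
        by_cases htp1 : t = p - 1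
        · right
          have := h2 htp1
          exact ⟨htp1, lt_of_lt_of_le (hlow _ (by omega)) hpw⟩
        · left
          exact ⟨by omega, lt_of_lt_of_le (hlow _ (by omega)) hpw⟩

lemma good_all {p : ℕ} (hp : p.Prime) : ∀ (N : ℕ) (α : Type) [Finite α], Nat.card α = N → Good p α := by
  intro N
  induction N using Nat.strong_induction_on with
  | _ N ih =>
  intro α _ hN H hH hb
  classical
  have := Fintype.ofFinite α
  have IH : ∀ (β : Type) [Finite β], Nat.card β < Nat.card α → Good p β := by
    intro β _ hβ
    exact ih _ (hN ▸ hβ) β rfl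
  have hnt : Nontrivial α := by
    by_contra hc
    rw [not_nontrivial_iff_subsingleton] at hc
    apply hb
    rw [Subgroup.eq_bot_iff_forall]
    intro f _
    exact Equiv.ext fun a => Subsingleton.elim _ _
  have hn : 2 ≤ Nat.card α := by
    rw [Nat.card_eq_fintype_card]; exact Fintype.one_lt_card
  by_cases htr : MulAction.IsPretransitive H α
  · by_cases hprim : MulAction.IsPreprimitive H α
    · rw [kk_trans H htr]
      by_contra hc
      push Not at hc
      have hbig : p ^ (Nat.card α - 1) ≤ Nat.card H := by
        rw [show Nat.card α = (Nat.card α - 1) + 1 by omega, pow_succ, pow_one] at hc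
        simpa using Nat.le_of_mul_le_mul_right hc hp.pos
      rcases Nat.lt_or_ge (Nat.card α) p with h | h
      · have := small_n H hn h
        omega
      · exact prim_contra hp IH H hH hn hprim h hbig
    · exact imprim hp IH H hH hprim
  · obtain ⟨a, b, hab⟩ : ∃ a b : α, ¬ (orb H) a b := by
      by_contra hc
      push Not at hc
      apply htr
      refine ⟨fun x y => ?_⟩
      obtain ⟨h, hh, e⟩ := hc x y
      exact ⟨⟨h, hh⟩, e⟩
    refine intrans hp IH H hH hb {x | (orb H) a x} ?_ ⟨a, (orb H).refl a⟩ ⟨b, hab⟩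
    intro h hh x
    constructor
    · intro hx
      exact (orb H).trans hx ((orb H).symm ⟨h, hh, rfl⟩)
    · intro hx
      exact (orb H).trans hx ⟨h, hh, rfl⟩

end PG

theorem stmt_0 (p n : ℕ) (hp : p.Prime) (hn : 1 < n)
    (G : Subgroup (Equiv.Perm (Fin n))) (hG : ¬ p ∣ Nat.card G) :
    Nat.card G < p ^ (n - 1) := by
  by_cases hb : G = ⊥
  · subst hb
    simp only [Subgroup.card_bot]
    exact Nat.one_lt_pow (by omega) hp.one_lt
  · have h1 := PG.good_all hp n (Fin n) (by simp) G hG hb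
    have h2 : 1 ≤ PG.kk G := by
      have : Nonempty (Fin n) := ⟨⟨0, by omega⟩⟩
      exact PG.kk_pos G
    rw [Nat.card_eq_fintype_card (α := Fin n), Fintype.card_fin] at h1
    by_contra hc
    push Not at hc
    have h3 : p ^ n ≤ Nat.card G * p ^ PG.kk G := by
      calc p ^ n = p ^ (n - 1) * p ^ 1 := by rw [← pow_add]; congr 1; omega
        _ ≤ _ := Nat.mul_le_mul hc (Nat.pow_le_pow_right hp.pos h2)
    omega
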